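/- arXiv:2409.01182 — 4 statements merged into one kernel-verified Lean document; each statement's English description precedes it below -/
import Mathlib

section
/- Let 0 < δ < π/2 and F(w) = w + sin(w). Then F is injective on the open half-strip {w ∈ ℂ : |Re w| < π/2 + δ, Im w > 0}, and likewise injective on {w ∈ ℂ : |Re w| < π/2 + δ, Im w < 0}. Moreover F′(w) = 1 + cos(w) does not vanish on these half-strips. -/
open Complex Set

/-- The conformal map `F(w) = w + sin w`. -/
noncomputable def Fmap (w : ℂ) : ℂ := w + Complex.sin w

theorem Real.id_add_sin_monotone : Monotone fun u : ℝ => u + Real.sin u := by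
  refine monotone_of_hasDerivAt_nonneg (f' := fun u => 1 + Real.cos u)
    (fun u => (hasDerivAt_id u).add (Real.hasDerivAt_sin u)) fun u => ?_
  have := Real.neg_one_le_cos u
  simp only [Pi.zero_apply]
  linarith

/-- Along the level curve `u + sin u * cosh v = c` of the real part of `w + sin w`, the imaginary
part is strictly decreasing in `u`. -/
theorem im_lt_im_of_re_eq {u₁ v₁ u₂ v₂ : ℝ} (hu₁ : 0 < u₁) (hu : u₁ < u₂) (hu₂ : u₂ < Real.pi)
    (hv₁ : 0 < v₁) (hv₂ : 0 < v₂)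
    (h : u₁ + Real.sin u₁ * Real.cosh v₁ = u₂ + Real.sin u₂ * Real.cosh v₂) :
    v₂ + Real.cos u₂ * Real.sinh v₂ < v₁ + Real.cos u₁ * Real.sinh v₁ := by
  obtain ⟨c, hc⟩ : ∃ c, c = u₂ + Real.sin u₂ * Real.cosh v₂ := ⟨_, rfl⟩
  rw [← hc] at h
  have hsin : ∀ u ∈ Icc u₁ u₂, 0 < Real.sin u := fun u hu =>
    Real.sin_pos_of_pos_of_lt_pi (by linarith [hu.1]) (by linarith [hu.2])
  have hr : ∀ u ∈ Icc u₁ u₂, 1 < (c - u) / Real.sin u := by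
    intro u hu'
    rw [lt_div_iff₀ (hsin u hu')]
    have h1 : u + Real.sin u ≤ u₂ + Real.sin u₂ := Real.id_add_sin_monotone hu'.2
    have h2 := Real.one_lt_cosh.2 hv₂.ne'
    have h3 := hsin u₂ ⟨hu.le, le_rfl⟩
    nlinarith
  have hlevel : ∀ u ∈ Icc u₁ u₂, ∀ v, 0 < v → u + Real.sin u * Real.cosh v = c →
      Real.arcosh ((c - u) / Real.sin u) = v := by
    intro u hu' v hv huv
    have hs := (hsin u hu').ne'
    have : (c - u) / Real.sin u = Real.cosh v := by
      field_simp
      linarith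
    rw [this, Real.arcosh_cosh hv.le]
  let V : ℝ → ℝ := fun u => Real.arcosh ((c - u) / Real.sin u) +
    Real.cos u * Real.sinh (Real.arcosh ((c - u) / Real.sin u))
  have hderiv : ∀ u ∈ Icc u₁ u₂, ∃ d < 0, HasDerivAt V d u := by
    intro u hu'
    have hs := hsin u hu'
    have hr1 := hr u hu'
    have hrd : HasDerivAt (fun u => (c - u) / Real.sin u) _ u :=
      ((hasDerivAt_id u).const_sub c).div (Real.hasDerivAt_sin u) hs.ne'
    have hvd := (Real.hasDerivAt_arcosh hr1).comp u hrd
    have hVd := hvd.add ((Real.hasDerivAt_cos u).mul hvd.sinh)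
    refine ⟨_, ?_, hVd⟩
    simp only [Function.comp_apply, id]
    rw [Real.cosh_arcosh hr1.le, Real.sinh_arcosh hr1.le]
    have hcu : c - u = (c - u) / Real.sin u * Real.sin u := by field_simp
    generalize (c - u) / Real.sin u = r at *
    rw [hcu]
    have hS : 0 < √(r ^ 2 - 1) := Real.sqrt_pos.2 (by nlinarith)
    generalize √(r ^ 2 - 1) = S at *
    have key : S⁻¹ * ((-1 * Real.sin u - r * Real.sin u * Real.cos u) / Real.sin u ^ 2) +
        (-Real.sin u * S + Real.cos u *
          (r * (S⁻¹ * ((-1 * Real.sin u - r * Real.sin u * Real.cos u) / Real.sin u ^ 2)))) =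
        -(((1 + r * Real.cos u) ^ 2 + (Real.sin u * S) ^ 2) / (Real.sin u * S)) := by
      field_simp
      ring
    rw [key]
    have : 0 < Real.sin u * S := mul_pos hs hS
    exact neg_neg_of_pos (by positivity)
  have hanti : StrictAntiOn V (Icc u₁ u₂) := by
    refine strictAntiOn_of_deriv_neg (convex_Icc _ _) (fun u hu' => ?_) fun u hu' => ?_
    · obtain ⟨d, -, hd⟩ := hderiv u hu'
      exact hd.continuousAt.continuousWithinAt
    · obtain ⟨d, hd0, hd⟩ := hderiv u (interior_subset hu')
      rwa [hd.deriv]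
  have hmem₁ : u₁ ∈ Icc u₁ u₂ := ⟨le_rfl, hu.le⟩
  have hmem₂ : u₂ ∈ Icc u₁ u₂ := ⟨hu.le, le_rfl⟩
  have := hanti hmem₁ hmem₂ hu
  simpa only [V, hlevel u₁ hmem₁ v₁ hv₁ h, hlevel u₂ hmem₂ v₂ hv₂ hc.symm] using this

theorem eq_of_re_eq_of_im_eq_of_pos {u₁ v₁ u₂ v₂ : ℝ} (hu₁ : 0 < u₁) (hu₁' : u₁ < Real.pi)
    (hu₂ : 0 < u₂) (hu₂' : u₂ < Real.pi) (hv₁ : 0 < v₁) (hv₂ : 0 < v₂)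
    (hre : u₁ + Real.sin u₁ * Real.cosh v₁ = u₂ + Real.sin u₂ * Real.cosh v₂)
    (him : v₁ + Real.cos u₁ * Real.sinh v₁ = v₂ + Real.cos u₂ * Real.sinh v₂) :
    u₁ = u₂ ∧ v₁ = v₂ := by
  rcases lt_trichotomy u₁ u₂ with h | rfl | h
  · exact absurd him (im_lt_im_of_re_eq hu₁ h hu₂' hv₁ hv₂ hre).ne'
  · have hs := (Real.sin_pos_of_pos_of_lt_pi hu₁ hu₁').ne'
    have : Real.cosh v₁ = Real.cosh v₂ := mul_left_cancel₀ hs (by linarith)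
    refine ⟨rfl, ?_⟩
    rw [← Real.arcosh_cosh hv₁.le, this, Real.arcosh_cosh hv₂.le]
  · exact absurd him (im_lt_im_of_re_eq hu₂ h hu₁' hv₂ hv₁ hre.symm).ne

theorem add_sin_mul_cosh_pos {u v : ℝ} (hu : 0 < u) (hu' : u < Real.pi) :
    0 < u + Real.sin u * Real.cosh v :=
  add_pos hu (mul_pos (Real.sin_pos_of_pos_of_lt_pi hu hu') (Real.cosh_pos v))

theorem add_sin_mul_cosh_neg {u v : ℝ} (hu : u < 0) (hu' : -Real.pi < u) :
    u + Real.sin u * Real.cosh v < 0 := by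
  have := add_sin_mul_cosh_pos (v := v) (neg_pos.2 hu) (by linarith)
  rw [Real.sin_neg] at this
  linarith

theorem eq_of_re_eq_of_im_eq {u₁ v₁ u₂ v₂ : ℝ} (hu₁ : |u₁| < Real.pi) (hu₂ : |u₂| < Real.pi)
    (hv₁ : 0 < v₁) (hv₂ : 0 < v₂)
    (hre : u₁ + Real.sin u₁ * Real.cosh v₁ = u₂ + Real.sin u₂ * Real.cosh v₂)
    (him : v₁ + Real.cos u₁ * Real.sinh v₁ = v₂ + Real.cos u₂ * Real.sinh v₂) :
    u₁ = u₂ ∧ v₁ = v₂ := by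
  rw [abs_lt] at hu₁ hu₂
  rcases lt_trichotomy u₁ 0 with h₁ | rfl | h₁ <;> rcases lt_trichotomy u₂ 0 with h₂ | rfl | h₂
  · have := eq_of_re_eq_of_im_eq_of_pos (u₁ := -u₁) (u₂ := -u₂) (by linarith) (by linarith)
      (by linarith) (by linarith) hv₁ hv₂ (by simp only [Real.sin_neg]; linarith)
      (by simpa only [Real.cos_neg] using him)
    exact ⟨neg_injective this.1, this.2⟩
  · have := add_sin_mul_cosh_neg (v := v₁) h₁ hu₁.1
    simp at hre
    linarith
  · have := add_sin_mul_cosh_neg (v := v₁) h₁ hu₁.1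
    have := add_sin_mul_cosh_pos (v := v₂) h₂ hu₂.2
    linarith
  · have := add_sin_mul_cosh_neg (v := v₂) h₂ hu₂.1
    simp at hre
    linarith
  · refine ⟨rfl, ?_⟩
    have hmono : StrictMono fun v : ℝ => v + Real.sinh v := strictMono_id.add Real.sinh_strictMono
    exact hmono.injective (by simpa using him)
  · have := add_sin_mul_cosh_pos (v := v₂) h₂ hu₂.2
    simp at hre
    linarith
  · have := add_sin_mul_cosh_neg (v := v₂) h₂ hu₂.1
    have := add_sin_mul_cosh_pos (v := v₁) h₁ hu₁.2
    linarith
  · have := add_sin_mul_cosh_pos (v := v₁) h₁ hu₁.2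
    simp at hre
    linarith
  · exact eq_of_re_eq_of_im_eq_of_pos h₁ hu₁.2 h₂ hu₂.2 hv₁ hv₂ hre him

theorem Fmap_re (w : ℂ) : (Fmap w).re = w.re + Real.sin w.re * Real.cosh w.im := by
  rw [Fmap, Complex.sin_eq, ← Complex.ofReal_sin, ← Complex.ofReal_cos, ← Complex.ofReal_sinh,
    ← Complex.ofReal_cosh]
  simp [-Complex.ofReal_sin, -Complex.ofReal_cos, -Complex.ofReal_sinh, -Complex.ofReal_cosh]

theorem Fmap_im (w : ℂ) : (Fmap w).im = w.im + Real.cos w.re * Real.sinh w.im := by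
  rw [Fmap, Complex.sin_eq, ← Complex.ofReal_sin, ← Complex.ofReal_cos, ← Complex.ofReal_sinh,
    ← Complex.ofReal_cosh]
  simp [-Complex.ofReal_sin, -Complex.ofReal_cos, -Complex.ofReal_sinh, -Complex.ofReal_cosh]

theorem Fmap_injOn_upper : InjOn Fmap {w : ℂ | |w.re| < Real.pi ∧ 0 < w.im} := by
  rintro z ⟨hz, hz'⟩ w ⟨hw, hw'⟩ h
  have hre := congrArg Complex.re h
  have him := congrArg Complex.im h
  rw [Fmap_re, Fmap_re] at hre
  rw [Fmap_im, Fmap_im] at him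
  obtain ⟨h1, h2⟩ := eq_of_re_eq_of_im_eq hz hw hz' hw' hre him
  exact Complex.ext h1 h2

theorem Fmap_neg (w : ℂ) : Fmap (-w) = -Fmap w := by
  simp only [Fmap, Complex.sin_neg]
  ring

theorem Fmap_injOn_lower : InjOn Fmap {w : ℂ | |w.re| < Real.pi ∧ w.im < 0} := by
  rintro z ⟨hz, hz'⟩ w ⟨hw, hw'⟩ h
  refine neg_injective (Fmap_injOn_upper ?_ ?_ (by rw [Fmap_neg, Fmap_neg, h]))
  · exact ⟨by simpa using hz, by simpa using hz'⟩
  · exact ⟨by simpa using hw, by simpa using hw'⟩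

theorem hasDerivAt_Fmap (w : ℂ) : HasDerivAt Fmap (1 + Complex.cos w) w :=
  (hasDerivAt_id w).add (Complex.hasDerivAt_sin w)

theorem one_add_cos_ne_zero {w : ℂ} (hw : |w.re| < Real.pi) (hw' : w.im ≠ 0) :
    1 + Complex.cos w ≠ 0 := by
  intro h
  rw [Complex.cos_eq, ← Complex.ofReal_sin, ← Complex.ofReal_cos, ← Complex.ofReal_sinh,
    ← Complex.ofReal_cosh] at h
  have hre := congrArg Complex.re h
  have him := congrArg Complex.im h
  simp [-Complex.ofReal_sin, -Complex.ofReal_cos, -Complex.ofReal_sinh, -Complex.ofReal_cosh]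
    at hre him
  rw [abs_lt] at hw
  have h0 : w.re = 0 :=
    (Real.sin_eq_zero_iff_of_lt_of_lt hw.1 hw.2).1 (him.resolve_right hw')
  rw [h0, Real.cos_zero] at hre
  linarith [Real.cosh_pos w.im]

/-- for `0 < δ < π/2`, `F(w) = w + sin w` is injective on the open upper
half-strip `{|Re w| < π/2 + δ, Im w > 0}` and on the lower half-strip
`{|Re w| < π/2 + δ, Im w < 0}`; moreover on these half-strips `F′(w) = 1 + cos w`
does not vanish. -/
theorem statement4 (δ : ℝ) (hδ0 : 0 < δ) (hδ : δ < Real.pi / 2) :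
    Set.InjOn Fmap {w : ℂ | |w.re| < Real.pi / 2 + δ ∧ 0 < w.im} ∧
    Set.InjOn Fmap {w : ℂ | |w.re| < Real.pi / 2 + δ ∧ w.im < 0} ∧
    (∀ w : ℂ, |w.re| < Real.pi / 2 + δ → w.im ≠ 0 →
      deriv Fmap w = 1 + Complex.cos w ∧ 1 + Complex.cos w ≠ 0) := by
  have hlt : Real.pi / 2 + δ < Real.pi := by linarith
  exact ⟨Fmap_injOn_upper.mono fun _ hw => hw.imp_left (lt_trans · hlt),
    Fmap_injOn_lower.mono fun _ hw => hw.imp_left (lt_trans · hlt),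
    fun w hw hw' => ⟨(hasDerivAt_Fmap w).deriv, one_add_cos_ne_zero (hw.trans hlt) hw'⟩⟩
end

section
/- Let 0 < δ < π/2 and F(w) = w + sin(w). There is a constant C > 0 such that for every w ∈ ℂ with Re w ∈ (−π/2 − δ, π/2 + δ), Im w ≥ 0, and |F(w)| ≥ 2, one has |Re(cos(w)) − (Im F(w) − log(2|F(w)|))| ≤ C · log|F(w)| / |F(w)|. -/
open Complex

/-- In the upper half plane, `2 ‖sin w‖` differs from `exp (Im w)` by at most `1`. -/
lemma abs_two_mul_norm_sin_sub_exp_im_le {w : ℂ} (hw : 0 ≤ w.im) :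
    |2 * ‖Complex.sin w‖ - Real.exp w.im| ≤ 1 := by
  have h2 : 2 * ‖Complex.sin w‖ = ‖Complex.exp (-w * I) - Complex.exp (w * I)‖ := by
    rw [Complex.sin, norm_div, norm_mul, norm_I, Complex.norm_ofNat]
    ring
  have h3 : ‖Complex.exp (-w * I)‖ = Real.exp w.im := by simp [Complex.norm_exp]
  have h4 : ‖Complex.exp (w * I)‖ ≤ 1 := by simpa [Complex.norm_exp] using hw
  rw [h2, ← h3]
  refine (abs_norm_sub_norm_le _ _).trans ?_
  simpa using h4

lemma abs_two_mul_norm_Fmap_sub_exp_im_le {w : ℂ} (hw : 0 ≤ w.im) :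
    |2 * ‖Fmap w‖ - Real.exp w.im| ≤ 2 * ‖w‖ + 1 := by
  have h1 := abs_le.mp (abs_two_mul_norm_sin_sub_exp_im_le hw)
  have h2 : |‖Fmap w‖ - ‖Complex.sin w‖| ≤ ‖w‖ := by
    simpa [Fmap] using abs_norm_sub_norm_le (Fmap w) (Complex.sin w)
  have h3 := abs_le.mp h2
  exact abs_le.mpr ⟨by linarith [h1.1, h3.1], by linarith [h1.2, h3.2]⟩

lemma cos_re_sub_Fmap_im (w : ℂ) :
    (Complex.cos w).re - (Fmap w).im = Real.cos w.re * Real.exp (-w.im) - w.im := by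
  have hc : (Complex.cos w).re = Real.cos w.re * Real.cosh w.im := by
    rw [Complex.cos_eq]
    simp [Complex.cos_ofReal_re, Complex.cosh_ofReal_re]
  have hs : (Complex.sin w).im = Real.cos w.re * Real.sinh w.im := by
    rw [Complex.sin_eq]
    simp [Complex.cos_ofReal_re, Complex.sinh_ofReal_re]
  rw [Fmap, add_im, hc, hs, ← Real.cosh_sub_sinh]
  ring

lemma abs_log_sub_log_le {a b : ℝ} (ha : 0 < a) (hb : 0 < b) :
    |Real.log a - Real.log b| ≤ |a - b| * (1 / a + 1 / b) := by
  have h1 : Real.log a - Real.log b ≤ (a - b) * (1 / b) := by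
    rw [← Real.log_div ha.ne' hb.ne']
    refine (Real.log_le_sub_one_of_pos (div_pos ha hb)).trans_eq ?_
    field_simp
  have h2 : Real.log b - Real.log a ≤ (b - a) * (1 / a) := by
    rw [← Real.log_div hb.ne' ha.ne']
    refine (Real.log_le_sub_one_of_pos (div_pos hb ha)).trans_eq ?_
    field_simp
  have ha' : 0 < 1 / a := by positivity
  have hb' : 0 < 1 / b := by positivity
  have h3 := mul_le_mul_of_nonneg_right (le_abs_self (a - b)) hb'.le
  have h4 := mul_le_mul_of_nonneg_right (neg_le_abs (a - b)) ha'.le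
  have h5 := mul_nonneg (abs_nonneg (a - b)) ha'.le
  have h6 := mul_nonneg (abs_nonneg (a - b)) hb'.le
  rw [abs_le]
  constructor <;> nlinarith

/-- asymptotic expansion of the hairpin stream function in strip coordinates:
`|Re(cos w) − (Im F(w) − log(2|F(w)|))| ≤ C log|F(w)| / |F(w)|` for `w` in the upper part
of the widened strip with `|F(w)| ≥ 2`. -/
theorem statement6 (δ : ℝ) (hδ0 : 0 < δ) (hδ : δ < Real.pi / 2) :
    ∃ C : ℝ, 0 < C ∧
      ∀ w : ℂ, -(Real.pi / 2 + δ) < w.re → w.re < Real.pi / 2 + δ → 0 ≤ w.im →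
        2 ≤ ‖Fmap w‖ →
        |(Complex.cos w).re - ((Fmap w).im - Real.log (2 * ‖Fmap w‖))| ≤
          C * Real.log ‖Fmap w‖ / ‖Fmap w‖ := by
  refine ⟨400, by norm_num, fun w hre₁ hre₂ him hF => ?_⟩
  have hre : |w.re| ≤ 3.15 := by
    rw [abs_le]
    constructor <;> linarith [Real.pi_lt_d2]
  have hw : ‖w‖ ≤ 3.15 + w.im := by
    have h := Complex.norm_le_abs_re_add_abs_im w
    rw [abs_of_nonneg him] at h
    linarith
  have hdiff := abs_two_mul_norm_Fmap_sub_exp_im_le him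
  have hid : (Complex.cos w).re - ((Fmap w).im - Real.log (2 * ‖Fmap w‖)) =
      Real.cos w.re * Real.exp (-w.im) + (Real.log (2 * ‖Fmap w‖) - w.im) := by
    linarith [cos_re_sub_Fmap_im w]
  rw [hid]
  set D := ‖Fmap w‖
  set y := w.im
  have hD : 0 < D := by linarith
  replace hdiff : |2 * D - Real.exp y| ≤ 7.3 + 2 * y := by linarith
  have hdiff' := abs_le.mp hdiff
  have hE1 : y + 1 ≤ Real.exp y := Real.add_one_le_exp y
  have hlog2 : 1 ≤ 2 * Real.log D := by
    have := Real.log_le_log two_pos hF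
    linarith [Real.log_two_gt_d9]
  have hy : y ≤ 5 * Real.log D := by
    have h4 : 4 * (y - 1) ≤ Real.exp y := by
      have h1 := Real.add_one_le_exp (y - 2)
      have h2 : Real.exp y = Real.exp (y - 2) * (Real.exp 1 * Real.exp 1) := by
        rw [← Real.exp_add, ← Real.exp_add]
        ring_nf
      have h3 : 4 ≤ Real.exp 1 * Real.exp 1 := by nlinarith [Real.exp_one_gt_d9]
      have h5 := Real.exp_pos (y - 2)
      nlinarith
    have h16 : Real.exp y ≤ 2 ^ 4 * D := by linarith [hdiff'.1]
    have h := Real.log_le_log (Real.exp_pos y) h16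
    rw [Real.log_exp, Real.log_mul (by norm_num) hD.ne', Real.log_pow] at h
    have := Real.log_le_log two_pos hF
    push_cast at h
    linarith
  have hEinv : 1 / Real.exp y ≤ 11 * (1 / (2 * D)) := by
    rw [mul_one_div, div_le_div_iff₀ (Real.exp_pos y) (by positivity)]
    linarith [hdiff'.2]
  have hlog : |Real.log (2 * D) - y| ≤ (7.3 + 2 * y) * (12 * (1 / (2 * D))) := by
    have h := abs_log_sub_log_le (show 0 < 2 * D by positivity) (Real.exp_pos y)
    rw [Real.log_exp] at h
    refine h.trans (mul_le_mul hdiff (by linarith) (by positivity) (by linarith))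
  have hcos : |Real.cos w.re * Real.exp (-y)| ≤ 11 * (1 / (2 * D)) := by
    rw [abs_mul, Real.abs_exp, Real.exp_neg, ← one_div]
    exact (mul_le_of_le_one_left (by positivity) (Real.abs_cos_le_one _)).trans hEinv
  calc
    _ ≤ 11 * (1 / (2 * D)) + (7.3 + 2 * y) * (12 * (1 / (2 * D))) :=
      (abs_add_le _ _).trans (add_le_add hcos hlog)
    _ = (11 + 12 * (7.3 + 2 * y)) / 2 / D := by field_simp
    _ ≤ 400 * Real.log D / D := by
      gcongr
      linarith
end

section
/- Let S = {w ∈ ℂ : |Re w| < π/2}, 0 < σ < 1, 0 < α < 1, and let H be holomorphic on S, bounded and continuous on the closure of S; write H = h + i j with h, j real valued. Assume |h(w)| ≤ e^{−σ|Im w|} for all w in the closure of S, and that for w₁ ∈ {−π/2, π/2} and all t′, t″ ∈ ℝ with |t′ − t″| ≤ 1 one has |h(w₁ + i t′) − h(w₁ + i t″)| ≤ e^{−σ min(|t′|,|t″|)} |t′ − t″|^α. Then there exist real numbers U and L and a constant C such that |j(w) − U| ≤ C e^{−σ Im w} whenever Im w ≥ 0 and |j(w) − L| ≤ C e^{σ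 Im w} whenever Im w ≤ 0 (in particular j(w₁ + i t) → U as t → +∞ and → L as t → −∞, uniformly in w₁). Moreover t ↦ h(π/2 + i t) − h(−π/2 + i t) is integrable on ℝ, and if ∫_{−∞}^{∞} (h(π/2 + i t) − h(−π/2 + i t)) dt = 0 then U = L. -/
open Complex Set MeasureTheory

/-- The vertical strip `S = {|Re w| < π/2}`. -/
def SStrip : Set ℂ := {w : ℂ | |w.re| < Real.pi / 2}

open Filter Topology

theorem SStrip_eq_preimage : SStrip = re ⁻¹' Ioo (-(Real.pi / 2)) (Real.pi / 2) := by
  ext w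
  simp [SStrip, abs_lt]

theorem mem_closure_SStrip {w : ℂ} : w ∈ closure SStrip ↔ |w.re| ≤ Real.pi / 2 := by
  have hpi := Real.pi_pos
  rw [SStrip_eq_preimage, closure_preimage_re, closure_Ioo (by linarith)]
  simp [abs_le]

theorem isOpen_SStrip : IsOpen SStrip := by
  rw [SStrip_eq_preimage]
  exact isOpen_Ioo.preimage continuous_re

/-- The Borel–Carathéodory estimate for increments, on a disc with arbitrary centre. -/
theorem norm_sub_le_of_re_sub_le {f : ℂ → ℂ} {c z : ℂ} {R M : ℝ} (hM : 0 < M)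
    (hf : DifferentiableOn ℂ f (Metric.ball c R))
    (hre : ∀ w ∈ Metric.ball c R, (f w).re - (f c).re ≤ M) (hz : z ∈ Metric.ball c R) :
    ‖f z - f c‖ ≤ 2 * M * ‖z - c‖ / (R - ‖z - c‖) := by
  have hzR : ‖z - c‖ < R := by simpa [dist_eq_norm] using hz
  have hmaps : MapsTo (fun w : ℂ => c + w) (Metric.ball 0 R) (Metric.ball c R) := by
    intro w hw
    simpa [dist_eq_norm] using hw
  have key := borelCaratheodory_zero (f := fun w => f (c + w) - f c) (R := R) (z := z - c) hM
    ((hf.comp (by fun_prop) hmaps).sub_const _)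
    (fun w hw => by simpa using hre _ (hmaps hw)) ((norm_nonneg _).trans_lt hzR)
    (by simpa using hzR) (by simp)
  simpa using key

theorem re_cpow_ofReal (z : ℂ) {α : ℝ} (hα : α ≠ 0) :
    (z ^ (α : ℂ)).re = ‖z‖ ^ α * Real.cos (α * arg z) := by
  rcases eq_or_ne z 0 with rfl | hz
  · simp [hα, Real.zero_rpow hα]
  · have h1 : z ^ (α : ℂ) = ((‖z‖ ^ α : ℝ) : ℂ) * exp ((α * arg z : ℝ) * I) := by
      rw [cpow_def_of_ne_zero hz, Complex.log, Real.rpow_def_of_pos (norm_pos_iff.mpr hz),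
        ofReal_exp, ← Complex.exp_add]
      push_cast
      ring_nf
    rw [h1, re_ofReal_mul, exp_ofReal_mul_I_re]

theorem cos_mul_norm_rpow_le_re_cpow {z : ℂ} (hz : 0 ≤ z.re) {α : ℝ} (hα0 : 0 < α)
    (hα1 : α < 1) :
    Real.cos (α * (Real.pi / 2)) * ‖z‖ ^ α ≤ (z ^ (α : ℂ)).re := by
  rw [re_cpow_ofReal z hα0.ne', mul_comm, ← Real.cos_abs (α * arg z), abs_mul, abs_of_pos hα0]
  have harg := abs_arg_le_pi_div_two_iff.mpr hz
  have hpi := Real.pi_pos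
  gcongr
  apply Real.cos_le_cos_of_nonneg_of_le_pi (by positivity) (by nlinarith) (by gcongr)

theorem cos_mul_pi_div_two_pos {α : ℝ} (hα0 : 0 < α) (hα1 : α < 1) :
    0 < Real.cos (α * (Real.pi / 2)) := by
  have hpi := Real.pi_pos
  exact Real.cos_pos_of_mem_Ioo ⟨by nlinarith, by nlinarith⟩

/-- One-sided barrier estimate at a point of the left boundary line of the strip. -/
theorem re_sub_le_of_boundary_le {f : ℂ → ℂ} {α A a : ℝ} {w₀ : ℂ} (hα0 : 0 < α) (hα1 : α < 1)
    (hA : 0 ≤ A) (hw₀ : w₀.re = -(Real.pi / 2)) (hf : DiffContOnCl ℂ f SStrip)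
    (hbd : ∀ w ∈ closure SStrip, ‖w - w₀‖ ≤ 1 → (w.re = -(Real.pi / 2) ∨ ‖w - w₀‖ = 1) →
      (f w).re - a ≤ A * ‖w - w₀‖ ^ α)
    {w : ℂ} (hw : w ∈ closure SStrip) (hw1 : ‖w - w₀‖ ≤ 1) :
    (f w).re - a ≤ A / Real.cos (α * (Real.pi / 2)) * ‖w - w₀‖ ^ α := by
  have hpi := Real.pi_gt_three
  set c := Real.cos (α * (Real.pi / 2)) with hc
  have hcpos : 0 < c := cos_mul_pi_div_two_pos hα0 hα1
  have hc1 : c ≤ 1 := Real.cos_le_one _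
  have hre_le : ∀ z : ℂ, z.re - w₀.re ≤ ‖z - w₀‖ := fun z => by
    simpa using (le_abs_self _).trans (abs_re_le_norm (z - w₀))
  by_cases hside : w.re = -(Real.pi / 2) ∨ ‖w - w₀‖ = 1
  · refine (hbd w hw hw1 hside).trans ?_
    gcongr
    exact le_div_self hA hcpos hc1
  push Not at hside
  set V := SStrip ∩ Metric.ball w₀ 1 with hV
  have hwV : w ∈ V := by
    have h1 := hre_le w
    have h2 := abs_le.mp (mem_closure_SStrip.mp hw)
    refine ⟨abs_lt.mpr ⟨lt_of_le_of_ne h2.1 (Ne.symm hside.1), by linarith⟩, ?_⟩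
    simpa [dist_eq_norm] using lt_of_le_of_ne hw1 hside.2
  have hVS : closure V ⊆ closure SStrip := closure_mono inter_subset_left
  have hVB : ∀ z ∈ closure V, ‖z - w₀‖ ≤ 1 := fun z hz => by
    simpa [dist_eq_norm] using
      Metric.closure_ball_subset_closedBall (closure_mono inter_subset_right hz)
  have hVre : ∀ z ∈ closure V, 0 ≤ (z - w₀).re := fun z hz => by
    have := (abs_le.mp (mem_closure_SStrip.mp (hVS hz))).1
    simp only [sub_re, hw₀]
    linarith
  set g : ℂ → ℂ := fun z => exp (f z - a - (A / c : ℝ) * (z - w₀) ^ (α : ℂ)) with hg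
  have hgnorm : ∀ z, ‖g z‖ = Real.exp ((f z).re - a - A / c * ((z - w₀) ^ (α : ℂ)).re) := by
    intro z
    simp only [hg, norm_exp, sub_re, re_ofReal_mul, ofReal_re]
  have hgd : DiffContOnCl ℂ g V := by
    constructor
    · intro z hz
      have hzs : z - w₀ ∈ slitPlane := by
        left
        have := (abs_lt.mp (show |z.re| < Real.pi / 2 from hz.1)).1
        simp only [sub_re, hw₀]
        linarith
      have hfz : DifferentiableWithinAt ℂ f V z :=
        (hf.differentiableOn z hz.1).mono inter_subset_left
      have hpz : DifferentiableWithinAt ℂ (fun z => (z - w₀) ^ (α : ℂ)) V z :=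
        DifferentiableWithinAt.cpow_const (by fun_prop) hzs
      exact (((hfz.sub_const _).sub (hpz.const_mul _))).cexp
    · intro z hz
      have hfz : ContinuousWithinAt f (closure V) z := (hf.continuousOn z (hVS hz)).mono hVS
      have hpz : ContinuousWithinAt (fun z => (z - w₀) ^ (α : ℂ)) (closure V) z := by
        have h1 : ContinuousAt (fun z : ℂ => z ^ (α : ℂ)) (z - w₀) :=
          continuousAt_cpow_const_of_re_pos (Or.inl (hVre z hz)) (by simpa using hα0)
        exact (ContinuousAt.comp (f := fun z => z - w₀) h1 (by fun_prop)).continuousWithinAt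
      exact ((hfz.sub continuousWithinAt_const).sub (continuousWithinAt_const.mul hpz)).cexp
  have hfront : ∀ z ∈ frontier V, ‖g z‖ ≤ 1 := by
    intro z hz
    have hzc := frontier_subset_closure hz
    have hzV : z ∉ V := by
      rw [(isOpen_SStrip.inter Metric.isOpen_ball).frontier_eq] at hz
      exact hz.2
    have hzside : z.re = -(Real.pi / 2) ∨ ‖z - w₀‖ = 1 := by
      by_contra! hcon
      apply hzV
      have h1 := hre_le z
      have h2 := abs_le.mp (mem_closure_SStrip.mp (hVS hzc))
      have h3 := hVB z hzc
      refine ⟨abs_lt.mpr ⟨lt_of_le_of_ne h2.1 (Ne.symm hcon.1), by linarith⟩, ?_⟩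
      simpa [dist_eq_norm] using lt_of_le_of_ne h3 hcon.2
    rw [hgnorm, Real.exp_le_one_iff]
    have h1 := hbd z (hVS hzc) (hVB z hzc) hzside
    have h2 := cos_mul_norm_rpow_le_re_cpow (hVre z hzc) hα0 hα1
    have h3 : A * ‖z - w₀‖ ^ α = A / c * (c * ‖z - w₀‖ ^ α) := by field_simp
    have h4 : A / c * (c * ‖z - w₀‖ ^ α) ≤ A / c * ((z - w₀) ^ (α : ℂ)).re := by gcongr
    linarith
  have hfin := norm_le_of_forall_mem_frontier_norm_le
    (Metric.isBounded_ball.subset inter_subset_right) hgd hfront (subset_closure hwV)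
  rw [hgnorm, Real.exp_le_one_iff] at hfin
  have h5 : A / c * ((w - w₀) ^ (α : ℂ)).re ≤ A / c * ‖w - w₀‖ ^ α := by
    gcongr
    refine (re_le_norm _).trans ?_
    rw [norm_cpow_real]
  linarith

/-- `H` is holomorphic on the strip and continuous on its closure, its real part decays
exponentially and satisfies a weighted Hölder condition on the two boundary lines. -/
structure StripDecay (σ α : ℝ) (H : ℂ → ℂ) : Prop where
  diffContOnCl : DiffContOnCl ℂ H SStrip
  abs_re_le : ∀ w ∈ closure SStrip, |(H w).re| ≤ Real.exp (-σ * |w.im|)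
  holder : ∀ x : ℝ, (x = Real.pi / 2 ∨ x = -(Real.pi / 2)) →
      ∀ t' t'' : ℝ, |t' - t''| ≤ 1 →
        |(H ((x : ℂ) + (t' : ℂ) * Complex.I)).re -
            (H ((x : ℂ) + (t'' : ℂ) * Complex.I)).re| ≤
          Real.exp (-σ * min |t'| |t''|) * |t' - t''| ^ α

namespace StripDecay

variable {σ α : ℝ} {H : ℂ → ℂ}

theorem comp_neg (h : StripDecay σ α H) : StripDecay σ α (fun w => H (-w)) where
  diffContOnCl := by
    have hmaps : MapsTo (fun w : ℂ => -w) SStrip SStrip := fun w hw => by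
      simpa [SStrip] using hw
    exact h.diffContOnCl.comp (g := fun w : ℂ => -w) differentiable_neg.diffContOnCl hmaps
  abs_re_le w hw := by
    simpa using h.abs_re_le (-w) (by simpa [mem_closure_SStrip] using hw)
  holder x hx t' t'' ht := by
    have key := h.holder (-x) (by rcases hx with rfl | rfl <;> simp) (-t') (-t'')
      (by rwa [neg_sub_neg, abs_sub_comm])
    rw [abs_neg, abs_neg, neg_sub_neg, abs_sub_comm t'' t'] at key
    convert key using 5 <;> push_cast <;> ring_nf

theorem abs_re_le_of_abs_sub_le (h : StripDecay σ α H) (hσ : 0 < σ) {w : ℂ}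
    (hw : w ∈ closure SStrip) {t d : ℝ} (ht : |w.im - t| ≤ d) :
    |(H w).re| ≤ Real.exp (σ * d) * Real.exp (-σ * |t|) := by
  refine (h.abs_re_le w hw).trans ?_
  rw [← Real.exp_add, Real.exp_le_exp]
  have := abs_sub_abs_le_abs_sub t w.im
  rw [abs_sub_comm] at this
  nlinarith

/-- The Hölder estimate extends from the left boundary line into the strip. -/
theorem abs_re_sub_le (h : StripDecay σ α H) (hσ : 0 < σ) (hα0 : 0 < α) (hα1 : α < 1)
    {w w₀ : ℂ} (hw₀ : w₀.re = -(Real.pi / 2)) (hw : w ∈ closure SStrip)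
    (him : |w.im - w₀.im| ≤ Real.pi) :
    |(H w).re - (H w₀).re| ≤ 2 * Real.exp (σ * Real.pi) / Real.cos (α * (Real.pi / 2)) *
      Real.exp (-σ * |w₀.im|) * ‖w - w₀‖ ^ α := by
  have hpi := Real.pi_gt_three
  set A := 2 * Real.exp (σ * Real.pi) * Real.exp (-σ * |w₀.im|) with hA
  have hApos : 0 < A := by positivity
  have hw₀S : w₀ ∈ closure SStrip := by
    rw [mem_closure_SStrip, hw₀, abs_neg, abs_of_pos (by linarith)]
  have hfar : ∀ z ∈ closure SStrip, |z.im - w₀.im| ≤ Real.pi →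
      |(H z).re - (H w₀).re| ≤ A := by
    intro z hz hzim
    have h1 := h.abs_re_le_of_abs_sub_le hσ hz hzim
    have h2 := h.abs_re_le_of_abs_sub_le hσ hw₀S (t := w₀.im) (d := Real.pi) (by simp; linarith)
    have h3 := abs_sub (H z).re (H w₀).re
    rw [hA]
    linarith
  have hnear : ∀ z ∈ closure SStrip, ‖z - w₀‖ ≤ 1 →
      (z.re = -(Real.pi / 2) ∨ ‖z - w₀‖ = 1) →
      |(H z).re - (H w₀).re| ≤ A * ‖z - w₀‖ ^ α := by
    intro z hz hz1 hside
    have hzim : |z.im - w₀.im| ≤ ‖z - w₀‖ := by simpa using abs_im_le_norm (z - w₀)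
    rcases hside with hside | hside
    · have key := h.holder (-(Real.pi / 2)) (Or.inr rfl) z.im w₀.im (by linarith)
      have e1 : ((-(Real.pi / 2) : ℝ) : ℂ) + z.im * I = z := by
        rw [← hside, re_add_im]
      have e2 : ((-(Real.pi / 2) : ℝ) : ℂ) + w₀.im * I = w₀ := by
        rw [← hw₀, re_add_im]
      rw [e1, e2] at key
      refine key.trans ?_
      gcongr
      have hmin : |w₀.im| - 1 ≤ min |z.im| |w₀.im| := by
        have := abs_sub_abs_le_abs_sub w₀.im z.im
        rw [abs_sub_comm] at this
        refine le_min (by linarith) (by linarith)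
      have h1 : Real.exp (-σ * min |z.im| |w₀.im|) ≤
          Real.exp (σ * Real.pi) * Real.exp (-σ * |w₀.im|) := by
        rw [← Real.exp_add, Real.exp_le_exp]
        nlinarith
      have h2 : 0 < Real.exp (σ * Real.pi) * Real.exp (-σ * |w₀.im|) := by positivity
      rw [hA]
      linarith
    · rw [hside, Real.one_rpow, mul_one]
      exact hfar z hz (by linarith)
  have hc0 := cos_mul_pi_div_two_pos hα0 hα1
  have hc1 := Real.cos_le_one (α * (Real.pi / 2))
  have hgoal : 2 * Real.exp (σ * Real.pi) / Real.cos (α * (Real.pi / 2)) *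
      Real.exp (-σ * |w₀.im|) = A / Real.cos (α * (Real.pi / 2)) := by
    rw [hA]; ring
  rw [hgoal]
  rcases le_total ‖w - w₀‖ 1 with hw1 | hw1
  · rw [abs_le']
    constructor
    · exact re_sub_le_of_boundary_le hα0 hα1 hApos.le hw₀ h.diffContOnCl
        (fun z hz hz1 hs => (le_abs_self _).trans (hnear z hz hz1 hs)) hw hw1
    · have := re_sub_le_of_boundary_le (f := fun z => -H z) (a := -(H w₀).re)
        hα0 hα1 hApos.le hw₀ h.diffContOnCl.neg
        (fun z hz hz1 hs => by
          have h1 := (neg_le_abs _).trans (hnear z hz hz1 hs)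
          simp only [neg_re]
          linarith) hw hw1
      simp only [neg_re] at this
      linarith
  · calc |(H w).re - (H w₀).re| ≤ A := hfar w hw him
      _ ≤ A / Real.cos (α * (Real.pi / 2)) := le_div_self hApos.le hc0 hc1
      _ ≤ A / Real.cos (α * (Real.pi / 2)) * ‖w - w₀‖ ^ α :=
        le_mul_of_one_le_right (by positivity) (Real.one_le_rpow hw1 hα0.le)

/-- Horizontal oscillation of `H` between the left boundary line and the middle of the strip. -/
theorem exists_norm_sub_left_le (h : StripDecay σ α H) (hσ : 0 < σ) (hα0 : 0 < α)
    (hα1 : α < 1) :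
    ∃ C : ℝ, 0 ≤ C ∧ ∀ t u : ℝ, 0 ≤ u → u ≤ Real.pi / 2 →
      ‖H (⟨-(Real.pi / 2) + u, t⟩ : ℂ) - H (⟨-(Real.pi / 2), t⟩ : ℂ)‖ ≤
        C * Real.exp (-σ * |t|) := by
  have hpi := Real.pi_gt_three
  set K := 2 * Real.exp (σ * Real.pi) / Real.cos (α * (Real.pi / 2)) with hK
  have hKpos : 0 < K := div_pos (by positivity) (cos_mul_pi_div_two_pos hα0 hα1)
  set r : ℝ := (1 / 2 : ℝ) ^ α with hr
  have hr0 : 0 < r := by positivity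
  have hr1 : r < 1 := Real.rpow_lt_one (by norm_num) (by norm_num) hα0
  refine ⟨4 * K * Real.pi ^ α / (1 - r), div_nonneg (by positivity) (by linarith), ?_⟩
  intro t u hu0 hu1
  rcases hu0.eq_or_lt with rfl | hu0
  · simp only [add_zero, sub_self, norm_zero]
    exact mul_nonneg (div_nonneg (by positivity) (by linarith)) (Real.exp_pos _).le
  set w₀ : ℂ := ⟨-(Real.pi / 2), t⟩ with hw₀
  set p : ℕ → ℂ := fun n => ⟨-(Real.pi / 2) + u * (1 / 2) ^ n, t⟩ with hp
  have hw₀S : w₀ ∈ closure SStrip := by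
    rw [mem_closure_SStrip, abs_neg, abs_of_pos (by linarith)]
  have hun0 : ∀ n : ℕ, 0 < u * (1 / 2) ^ n := fun n => by positivity
  have hun1 : ∀ n : ℕ, u * (1 / 2) ^ n ≤ Real.pi / 2 := fun n =>
    (mul_le_of_le_one_right hu0.le (pow_le_one₀ (by norm_num) (by norm_num))).trans hu1
  have hpS : ∀ n, p n ∈ closure SStrip := fun n => by
    rw [mem_closure_SStrip, abs_le]
    constructor <;> simp only [hp] <;> linarith [hun0 n, hun1 n]
  have hpw : ∀ n, p n - w₀ = ((u * (1 / 2) ^ n : ℝ) : ℂ) := fun n => by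
    apply Complex.ext <;> simp only [hp, hw₀, sub_re, sub_im, ofReal_re, ofReal_im] <;> ring
  have hstep : ∀ n, dist (H (p n)) (H (p (n + 1))) ≤
      4 * K * Real.pi ^ α * Real.exp (-σ * |t|) * r ^ n := by
    intro n
    set v := u * (1 / 2) ^ n with hv
    have hv0 : 0 < v := hun0 n
    have hv1 : v ≤ Real.pi / 2 := hun1 n
    have hball : Metric.ball (p n) v ⊆ SStrip := by
      intro z hz
      have h1 : |z.re - (p n).re| < v := by
        have := abs_re_le_norm (z - p n)
        rw [sub_re] at this
        exact this.trans_lt (by simpa [dist_eq_norm] using hz)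
      have h2 : (p n).re = -(Real.pi / 2) + v := rfl
      rw [h2, abs_lt] at h1
      change |z.re| < Real.pi / 2
      rw [abs_lt]
      constructor <;> linarith [h1.1, h1.2]
    set B := K * Real.exp (-σ * |t|) * (2 * v) ^ α with hB
    have hBpos : 0 < B := by positivity
    have hosc : ∀ z ∈ Metric.ball (p n) v, |(H z).re - (H w₀).re| ≤ B := by
      intro z hz
      have hzn : ‖z - p n‖ < v := by simpa [dist_eq_norm] using hz
      have h1 : ‖z - w₀‖ ≤ 2 * v := by
        have h2 : z - w₀ = (z - p n) + (p n - w₀) := by ring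
        rw [h2]
        refine (norm_add_le _ _).trans ?_
        rw [hpw, norm_real, Real.norm_eq_abs, abs_of_pos hv0]
        linarith
      have h3 : |z.im - w₀.im| ≤ Real.pi := by
        have := abs_im_le_norm (z - w₀)
        rw [sub_im] at this
        linarith
      refine (h.abs_re_sub_le hσ hα0 hα1 (w₀ := w₀) rfl (subset_closure (hball hz)) h3).trans ?_
      rw [hB]
      gcongr
    have hsub : p (n + 1) - p n = ((-(v / 2) : ℝ) : ℂ) := by
      have h1 : p (n + 1) - p n = (p (n + 1) - w₀) - (p n - w₀) := by ring
      rw [h1, hpw, hpw, ← ofReal_sub]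
      congr 1
      rw [hv, pow_succ]
      ring
    have hnorm : ‖p (n + 1) - p n‖ = v / 2 := by
      rw [hsub, norm_real, Real.norm_eq_abs, abs_neg, abs_of_pos (by positivity)]
    have key := norm_sub_le_of_re_sub_le (f := H) (c := p n) (z := p (n + 1)) (R := v)
      (M := 2 * B) (by positivity) (h.diffContOnCl.differentiableOn.mono hball)
      (fun z hz => by
        have h1 := (abs_le.mp (hosc z hz)).2
        have h2 := (abs_le.mp (hosc (p n) (Metric.mem_ball_self hv0))).1
        linarith)
      (by rw [Metric.mem_ball, dist_eq_norm, hnorm]; linarith)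
    rw [dist_comm, dist_eq_norm]
    refine key.trans ?_
    rw [hnorm]
    have h1 : 2 * (2 * B) * (v / 2) / (v - v / 2) = 4 * B := by
      have : v - v / 2 = v / 2 := by ring
      rw [this]
      field_simp
      ring
    have h2 : (2 * v) ^ α ≤ Real.pi ^ α * r ^ n := by
      rw [hr, ← Real.rpow_natCast, ← Real.rpow_mul (by norm_num), mul_comm α,
        Real.rpow_mul (by norm_num), ← Real.mul_rpow (by positivity) (by positivity)]
      apply Real.rpow_le_rpow (by positivity) _ hα0.le
      rw [hv, Real.rpow_natCast, ← mul_assoc]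
      gcongr
      linarith
    rw [h1, hB]
    calc 4 * (K * Real.exp (-σ * |t|) * (2 * v) ^ α)
        ≤ 4 * (K * Real.exp (-σ * |t|) * (Real.pi ^ α * r ^ n)) := by gcongr
      _ = _ := by ring
  have hptend : Tendsto p atTop (𝓝[closure SStrip] w₀) := by
    refine tendsto_nhdsWithin_iff.mpr ⟨?_, Eventually.of_forall hpS⟩
    rw [← tendsto_sub_nhds_zero_iff]
    simp_rw [hpw]
    have h1 : Tendsto (fun n : ℕ => u * (1 / 2 : ℝ) ^ n) atTop (𝓝 (u * 0)) :=
      (tendsto_pow_atTop_nhds_zero_of_lt_one (by norm_num) (by norm_num)).const_mul u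
    rw [mul_zero] at h1
    exact_mod_cast (continuous_ofReal.tendsto 0).comp h1
  have hlim : Tendsto (fun n => H (p n)) atTop (𝓝 (H w₀)) :=
    (h.diffContOnCl.continuousOn w₀ hw₀S).tendsto.comp hptend
  have hfin := dist_le_of_le_geometric_of_tendsto₀ r _ hr1 hstep hlim
  rw [dist_eq_norm] at hfin
  have hp0 : p 0 = ⟨-(Real.pi / 2) + u, t⟩ := by simp [hp]
  rw [hp0] at hfin
  refine hfin.trans_eq ?_
  ring

theorem exists_abs_im_sub_axis_le_of_re_nonpos (h : StripDecay σ α H) (hσ : 0 < σ)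
    (hα0 : 0 < α) (hα1 : α < 1) :
    ∃ C : ℝ, 0 ≤ C ∧ ∀ w ∈ closure SStrip, w.re ≤ 0 →
      |(H w).im - (H (w.im * I)).im| ≤ C * Real.exp (-σ * |w.im|) := by
  have hpi := Real.pi_pos
  obtain ⟨C, hC, hb⟩ := h.exists_norm_sub_left_le hσ hα0 hα1
  refine ⟨2 * C, by positivity, fun w hw hre => ?_⟩
  have hw' := (abs_le.mp (mem_closure_SStrip.mp hw)).1
  have h1 := hb w.im (w.re + Real.pi / 2) (by linarith) (by linarith)
  have h2 := hb w.im (Real.pi / 2) (by linarith) le_rfl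
  have e1 : (⟨-(Real.pi / 2) + (w.re + Real.pi / 2), w.im⟩ : ℂ) = w := by
    apply Complex.ext <;> simp
  have e2 : (⟨-(Real.pi / 2) + Real.pi / 2, w.im⟩ : ℂ) = w.im * I := by
    apply Complex.ext <;> simp
  rw [e1] at h1
  rw [e2] at h2
  rw [← sub_im]
  refine (abs_im_le_norm _).trans ?_
  rw [← sub_sub_sub_cancel_right _ _ (H ⟨-(Real.pi / 2), w.im⟩)]
  refine (norm_sub_le _ _).trans ?_
  linarith

theorem exists_abs_im_sub_axis_le (h : StripDecay σ α H) (hσ : 0 < σ)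
    (hα0 : 0 < α) (hα1 : α < 1) :
    ∃ C : ℝ, 0 ≤ C ∧ ∀ w ∈ closure SStrip,
      |(H w).im - (H (w.im * I)).im| ≤ C * Real.exp (-σ * |w.im|) := by
  obtain ⟨C₁, hC₁, hb₁⟩ := h.exists_abs_im_sub_axis_le_of_re_nonpos hσ hα0 hα1
  obtain ⟨C₂, hC₂, hb₂⟩ := h.comp_neg.exists_abs_im_sub_axis_le_of_re_nonpos hσ hα0 hα1
  refine ⟨max C₁ C₂, le_max_of_le_left hC₁, fun w hw => ?_⟩
  rcases le_total w.re 0 with hre | hre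
  · refine (hb₁ w hw hre).trans ?_
    gcongr
    exact le_max_left _ _
  · have h1 := hb₂ (-w) (by simpa [mem_closure_SStrip] using hw) (by simpa using hre)
    simp only [neg_im, neg_neg, ofReal_neg, neg_mul, abs_neg] at h1
    rw [← neg_mul] at h1
    refine h1.trans ?_
    gcongr
    exact le_max_right _ _

theorem abs_im_axis_sub_le (h : StripDecay σ α H) (hσ : 0 < σ) {t s : ℝ} (ht : 0 ≤ t)
    (hts : t ≤ s) (hst : s ≤ t + 1) :
    |(H (s * I)).im - (H (t * I)).im| ≤ 8 * Real.exp (σ * (3 / 2)) * Real.exp (-σ * t) := by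
  have hpi := Real.pi_gt_three
  have hball : Metric.ball (t * I : ℂ) (3 / 2) ⊆ SStrip := by
    intro z hz
    have h1 := (abs_re_le_norm (z - t * I)).trans_lt (by simpa [dist_eq_norm] using hz)
    simp only [sub_re, mul_re, ofReal_re, I_re, ofReal_im, I_im, mul_zero, zero_mul,
      sub_zero] at h1
    exact h1.trans (by linarith)
  have hb : ∀ z ∈ Metric.ball (t * I : ℂ) (3 / 2),
      |(H z).re| ≤ Real.exp (σ * (3 / 2)) * Real.exp (-σ * t) := by
    intro z hz
    have h1 := (abs_im_le_norm (z - t * I)).trans_lt (by simpa [dist_eq_norm] using hz)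
    have h2 := h.abs_re_le_of_abs_sub_le hσ (subset_closure (hball hz)) (t := t) (d := 3 / 2)
      (by simpa using h1.le)
    rwa [abs_of_nonneg ht] at h2
  set B := Real.exp (σ * (3 / 2)) * Real.exp (-σ * t) with hB
  have hBpos : 0 < B := by positivity
  have hnorm : ‖(s * I - t * I : ℂ)‖ = s - t := by
    rw [← sub_mul, norm_mul, norm_I, mul_one, ← ofReal_sub, norm_real, Real.norm_eq_abs,
      abs_of_nonneg (by linarith)]
  have key := norm_sub_le_of_re_sub_le (f := H) (c := t * I) (z := s * I) (R := 3 / 2)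
    (M := 2 * B) (by positivity) (h.diffContOnCl.differentiableOn.mono hball)
    (fun z hz => by
      have h1 := (abs_le.mp (hb z hz)).2
      have h2 := (abs_le.mp (hb _ (Metric.mem_ball_self (by norm_num)))).1
      linarith)
    (by rw [Metric.mem_ball, dist_eq_norm, hnorm]; linarith)
  rw [← sub_im]
  refine (abs_im_le_norm _).trans (key.trans ?_)
  rw [hnorm, div_le_iff₀ (by linarith)]
  nlinarith

end StripDecay

/-- A function whose increments over unit steps decay exponentially has a limit at infinity,
approached exponentially fast. -/
theorem exists_abs_sub_le_of_abs_sub_le_exp {σ C : ℝ} (hσ : 0 < σ) (hC : 0 ≤ C) {g : ℝ → ℝ}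
    (hg : ∀ t s : ℝ, 0 ≤ t → t ≤ s → s ≤ t + 1 → |g s - g t| ≤ C * Real.exp (-σ * t)) :
    ∃ U C' : ℝ, 0 ≤ C' ∧ ∀ t : ℝ, 0 ≤ t → |g t - U| ≤ C' * Real.exp (-σ * t) := by
  set r := Real.exp (-σ) with hr
  have hr1 : r < 1 := Real.exp_lt_one_iff.mpr (by linarith)
  have hrn : ∀ n : ℕ, r ^ n = Real.exp (-σ * n) := fun n => by
    rw [hr, ← Real.exp_nat_mul, mul_comm]
  have hstep : ∀ n : ℕ, dist (g n) (g (n + 1 : ℕ)) ≤ C * r ^ n := by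
    intro n
    rw [dist_comm, Real.dist_eq, hrn]
    exact hg n (n + 1 : ℕ) (by positivity) (by simp) (by simp)
  obtain ⟨U, hU⟩ := cauchySeq_tendsto_of_complete
    (cauchySeq_of_le_geometric (f := fun n : ℕ => g n) r C hr1 hstep)
  have h1r : 0 < 1 - r := by linarith
  refine ⟨U, C + C / (1 - r), by positivity, fun t ht => ?_⟩
  have h1 := hg t ⌈t⌉₊ ht (Nat.le_ceil t) (Nat.ceil_lt_add_one ht).le
  have h2 := dist_le_of_le_geometric_of_tendsto r C hr1 hstep hU ⌈t⌉₊
  rw [Real.dist_eq, hrn] at h2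
  have h3 : Real.exp (-σ * ⌈t⌉₊) ≤ Real.exp (-σ * t) := by
    rw [Real.exp_le_exp]
    nlinarith [Nat.le_ceil t]
  have h4 : C * Real.exp (-σ * ⌈t⌉₊) / (1 - r) ≤ C / (1 - r) * Real.exp (-σ * t) := by
    rw [mul_div_right_comm]
    gcongr
  rw [abs_sub_comm] at h1
  have h5 := abs_sub_le (g t) (g ⌈t⌉₊) U
  linarith

theorem integrable_exp_neg_mul_abs {σ : ℝ} (hσ : 0 < σ) :
    Integrable (fun t : ℝ => Real.exp (-σ * |t|)) := by
  rw [← integrableOn_univ, ← Iic_union_Ioi (a := (0 : ℝ))]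
  refine IntegrableOn.union ?_ ?_
  · refine (integrableOn_exp_mul_Iic hσ 0).congr_fun (fun t ht => ?_) measurableSet_Iic
    simp [abs_of_nonpos (show t ≤ 0 from ht)]
  · refine (integrableOn_exp_mul_Ioi (neg_lt_zero.mpr hσ) 0).congr_fun (fun t ht => ?_)
      measurableSet_Ioi
    simp [abs_of_pos (show 0 < t from ht)]

namespace StripDecay

variable {σ α : ℝ} {H : ℂ → ℂ}

theorem exists_abs_im_sub_le_of_im_nonneg (h : StripDecay σ α H) (hσ : 0 < σ)
    (hα0 : 0 < α) (hα1 : α < 1) :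
    ∃ U C : ℝ, 0 ≤ C ∧ ∀ w ∈ closure SStrip, 0 ≤ w.im →
      |(H w).im - U| ≤ C * Real.exp (-σ * w.im) := by
  obtain ⟨C₁, hC₁, hb₁⟩ := h.exists_abs_im_sub_axis_le hσ hα0 hα1
  obtain ⟨U, C₂, hC₂, hb₂⟩ := exists_abs_sub_le_of_abs_sub_le_exp hσ (by positivity)
    (g := fun t : ℝ => (H (t * I)).im) (fun t s => h.abs_im_axis_sub_le hσ)
  refine ⟨U, C₁ + C₂, by positivity, fun w hw him => ?_⟩
  have h1 := hb₁ w hw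
  have h2 := hb₂ w.im him
  rw [abs_of_nonneg him] at h1
  have h3 := abs_sub_le (H w).im (H (w.im * I)).im U
  linarith

theorem continuous_line (h : StripDecay σ α H) {x : ℝ} (hx : |x| ≤ Real.pi / 2) :
    Continuous (fun t : ℝ => H ((x : ℂ) + (t : ℂ) * I)) :=
  h.diffContOnCl.continuousOn.comp_continuous (by fun_prop)
    (fun t => by simpa [mem_closure_SStrip] using hx)

theorem integrable_re_line (h : StripDecay σ α H) (hσ : 0 < σ) {x : ℝ}
    (hx : |x| ≤ Real.pi / 2) :
    Integrable (fun t : ℝ => (H ((x : ℂ) + (t : ℂ) * I)).re) := by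
  refine (integrable_exp_neg_mul_abs hσ).mono'
    (continuous_re.comp (h.continuous_line hx)).aestronglyMeasurable
    (Eventually.of_forall fun t => ?_)
  simpa using h.abs_re_le (x + t * I) (by simpa [mem_closure_SStrip] using hx)

/-- The imaginary part of Cauchy's theorem on the rectangle `[-π/2, π/2] × [-M, M]`. -/
theorem integral_rect_im_eq_zero (h : StripDecay σ α H) (M : ℝ) :
    (∫ x : ℝ in -(Real.pi / 2)..Real.pi / 2, (H (x + (-M : ℝ) * I)).im) -
      (∫ x : ℝ in -(Real.pi / 2)..Real.pi / 2, (H (x + M * I)).im) +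
      (∫ t : ℝ in -M..M, ((H ((Real.pi / 2 : ℝ) + (t : ℂ) * I)).re -
        (H ((-(Real.pi / 2) : ℝ) + (t : ℂ) * I)).re)) = 0 := by
  have hpi := Real.pi_pos
  have hle : -(Real.pi / 2) ≤ Real.pi / 2 := by linarith
  have hline : ∀ x : ℝ, |x| ≤ Real.pi / 2 → ∀ a b : ℝ,
      IntervalIntegrable (fun t : ℝ => H ((x : ℂ) + (t : ℂ) * I)) volume a b :=
    fun x hx a b => (h.continuous_line hx).intervalIntegrable a b
  have hhor : ∀ t : ℝ, IntervalIntegrable (fun x : ℝ => H ((x : ℂ) + (t : ℂ) * I)) volume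
      (-(Real.pi / 2)) (Real.pi / 2) := fun t => by
    refine ContinuousOn.intervalIntegrable ?_
    rw [uIcc_of_le hle]
    refine h.diffContOnCl.continuousOn.comp (by fun_prop) fun x hx => ?_
    simpa [mem_closure_SStrip, abs_le] using hx
  have hrect := integral_boundary_rect_eq_zero_of_continuousOn_of_differentiableOn H
    ⟨-(Real.pi / 2), -M⟩ ⟨Real.pi / 2, M⟩
    (h.diffContOnCl.continuousOn.mono fun z hz => by
      have hz1 := hz.1
      simp only [mem_preimage, uIcc_of_le hle] at hz1
      exact mem_closure_SStrip.mpr (abs_le.mpr hz1))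
    (h.diffContOnCl.differentiableOn.mono fun z hz => by
      have hz1 := hz.1
      simp only [mem_preimage, min_eq_left hle, max_eq_right hle] at hz1
      exact abs_lt.mpr hz1)
  have hR : |Real.pi / 2| ≤ Real.pi / 2 := (abs_of_pos (by linarith)).le
  have hL : |-(Real.pi / 2)| ≤ Real.pi / 2 := by rwa [abs_neg]
  have hre : ∀ x : ℝ, |x| ≤ Real.pi / 2 →
      (∫ t : ℝ in -M..M, H ((x : ℂ) + (t : ℂ) * I)).re =
        ∫ t : ℝ in -M..M, (H ((x : ℂ) + (t : ℂ) * I)).re :=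
    fun x hx => (reCLM.intervalIntegral_comp_comm (hline x hx (-M) M)).symm
  have him : ∀ t : ℝ, (∫ x : ℝ in -(Real.pi / 2)..Real.pi / 2, H ((x : ℂ) + (t : ℂ) * I)).im =
        ∫ x : ℝ in -(Real.pi / 2)..Real.pi / 2, (H ((x : ℂ) + (t : ℂ) * I)).im :=
    fun t => (imCLM.intervalIntegral_comp_comm (hhor t)).symm
  have key := congrArg Complex.im hrect
  simp only [add_im, sub_im, smul_eq_mul, I_mul_im, zero_im] at key
  rw [him, him, hre _ hR, hre _ hL] at key
  have hsplit := intervalIntegral.integral_sub (a := -M) (b := M) (μ := volume)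
    ((continuous_re.comp (h.continuous_line hR)).intervalIntegrable _ _)
    ((continuous_re.comp (h.continuous_line hL)).intervalIntegrable _ _)
  simp only [Function.comp_apply] at hsplit
  rw [hsplit]
  linarith

end StripDecay

theorem tendsto_intervalIntegral_of_abs_sub_le_exp {σ C U a b : ℝ} (hσ : 0 < σ)
    {g : ℝ → ℝ → ℝ} (hab : a ≤ b) (hg : ∀ M, ContinuousOn (g M) (Icc a b))
    (hb : ∀ M, 0 ≤ M → ∀ x ∈ Icc a b, |g M x - U| ≤ C * Real.exp (-σ * M)) :
    Tendsto (fun M => ∫ x in a..b, g M x) atTop (𝓝 ((b - a) * U)) := by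
  have hexp : Tendsto (fun M : ℝ => C * Real.exp (-σ * M) * |b - a|) atTop (𝓝 0) := by
    have h1 : Tendsto (fun M : ℝ => Real.exp (-σ * M)) atTop (𝓝 0) :=
      Real.tendsto_exp_atBot.comp (tendsto_id.const_mul_atTop_of_neg (neg_lt_zero.mpr hσ))
    simpa using (h1.const_mul C).mul_const |b - a|
  rw [← tendsto_sub_nhds_zero_iff]
  refine squeeze_zero_norm' ?_ hexp
  filter_upwards [eventually_ge_atTop 0] with M hM
  have hint : IntervalIntegrable (g M) volume a b :=
    ContinuousOn.intervalIntegrable (by rw [uIcc_of_le hab]; exact hg M)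
  have h1 : (∫ x in a..b, g M x) - (b - a) * U = ∫ x in a..b, (g M x - U) := by
    rw [intervalIntegral.integral_sub hint intervalIntegrable_const,
      intervalIntegral.integral_const, smul_eq_mul]
  rw [h1]
  refine intervalIntegral.norm_integral_le_of_norm_le_const fun x hx => ?_
  rw [uIoc_of_le hab] at hx
  exact hb M hM x (Ioc_subset_Icc_self hx)

/-- let `H = h + ij` be holomorphic on the strip `S`, bounded and continuous
on its closure, with `|h(w)| ≤ e^{−σ|Im w|}` and a weighted Hölder condition for `h` on the
two boundary lines.  Then `j` has limits `U` (as `Im w → +∞`) and `L` (as `Im w → −∞`) with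
exponential rates, `t ↦ h(π/2+it) − h(−π/2+it)` is integrable over `ℝ`, and if its integral
vanishes then `U = L`. -/
theorem statement10 (σ α : ℝ) (hσ0 : 0 < σ) (hσ1 : σ < 1) (hα0 : 0 < α) (hα1 : α < 1)
    (H : ℂ → ℂ) (hH : DifferentiableOn ℂ H SStrip)
    (hHc : ContinuousOn H (closure SStrip))
    (hHb : ∃ M : ℝ, ∀ w ∈ closure SStrip, ‖H w‖ ≤ M)
    (hre : ∀ w ∈ closure SStrip, |(H w).re| ≤ Real.exp (-σ * |w.im|))
    (hhold : ∀ x : ℝ, (x = Real.pi / 2 ∨ x = -(Real.pi / 2)) →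
      ∀ t' t'' : ℝ, |t' - t''| ≤ 1 →
        |(H ((x : ℂ) + (t' : ℂ) * Complex.I)).re -
            (H ((x : ℂ) + (t'' : ℂ) * Complex.I)).re| ≤
          Real.exp (-σ * min |t'| |t''|) * |t' - t''| ^ α) :
    ∃ U L C : ℝ,
      (∀ w ∈ closure SStrip, 0 ≤ w.im → |(H w).im - U| ≤ C * Real.exp (-σ * w.im)) ∧
      (∀ w ∈ closure SStrip, w.im ≤ 0 → |(H w).im - L| ≤ C * Real.exp (σ * w.im)) ∧
      Integrable (fun t : ℝ =>
        (H ((Real.pi / 2 : ℝ) + (t : ℂ) * Complex.I)).re -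
          (H ((-(Real.pi / 2) : ℝ) + (t : ℂ) * Complex.I)).re) ∧
      ((∫ t : ℝ, ((H ((Real.pi / 2 : ℝ) + (t : ℂ) * Complex.I)).re -
          (H ((-(Real.pi / 2) : ℝ) + (t : ℂ) * Complex.I)).re)) = 0 → U = L) := by
  have hpi := Real.pi_pos
  have hle : -(Real.pi / 2) ≤ Real.pi / 2 := by linarith
  have hR : |Real.pi / 2| ≤ Real.pi / 2 := (abs_of_pos (by linarith)).le
  have hL : |-(Real.pi / 2)| ≤ Real.pi / 2 := by rwa [abs_neg]
  have h : StripDecay σ α H := ⟨⟨hH, hHc⟩, hre, hhold⟩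
  obtain ⟨U, C₁, hC₁, hU⟩ := h.exists_abs_im_sub_le_of_im_nonneg hσ0 hα0 hα1
  obtain ⟨L, C₂, hC₂, hL'⟩ := h.comp_neg.exists_abs_im_sub_le_of_im_nonneg hσ0 hα0 hα1
  have hlower : ∀ w ∈ closure SStrip, w.im ≤ 0 →
      |(H w).im - L| ≤ C₂ * Real.exp (σ * w.im) := by
    intro w hw him
    simpa using hL' (-w) (by simpa [mem_closure_SStrip] using hw) (by simpa using him)
  have hint := (h.integrable_re_line hσ0 hR).sub (h.integrable_re_line hσ0 hL)
  refine ⟨U, L, max C₁ C₂, fun w hw him => (hU w hw him).trans ?_,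
    fun w hw him => (hlower w hw him).trans ?_, hint, fun hzero => ?_⟩
  · gcongr
    exact le_max_left _ _
  · gcongr
    exact le_max_right _ _
  have hmem : ∀ M : ℝ, ∀ x ∈ Icc (-(Real.pi / 2)) (Real.pi / 2),
      (x + M * I : ℂ) ∈ closure SStrip := fun M x hx => by
    simpa [mem_closure_SStrip, abs_le] using hx
  have hcont : ∀ M : ℝ, ContinuousOn (fun x : ℝ => (H (x + M * I)).im)
      (Icc (-(Real.pi / 2)) (Real.pi / 2)) := fun M =>
    continuous_im.comp_continuousOn (hHc.comp (by fun_prop) (hmem M))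
  have htop := tendsto_intervalIntegral_of_abs_sub_le_exp hσ0 hle hcont
    (fun M hM x hx => by simpa using hU _ (hmem M x hx) (by simpa using hM))
  have hbot := tendsto_intervalIntegral_of_abs_sub_le_exp hσ0 hle (fun M => hcont (-M))
    (fun M hM x hx => by simpa using hlower _ (hmem (-M) x hx) (by simpa using hM))
  have hside := intervalIntegral_tendsto_integral hint tendsto_neg_atTop_atBot tendsto_id
  have hsum := (hbot.sub htop).add hside
  have heq := tendsto_nhds_unique hsum
    (tendsto_const_nhds.congr fun M => (h.integral_rect_im_eq_zero M).symm)
  simp only [Pi.sub_apply] at heq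
  rw [hzero] at heq
  have hprod : Real.pi * (U - L) = 0 := by linarith
  rcases mul_eq_zero.mp hprod with h0 | h0
  · exact absurd h0 hpi.ne'
  · linarith
end

section
/- Let S₀ = ℝ × (0, π) ⊆ ℝ², 0 < σ < 1, and 0 < α < 1. Suppose u is continuous on the closure of S₀, harmonic in S₀, satisfies |u(x₁,x₂)| ≤ e^{−σ|x₁|} on the closure of S₀, and satisfies: for all x₁ ∈ ℝ, x₂ ∈ {0, π}, and x₁′, x₁″ ∈ [x₁ − 1, x₁ + 1], |u(x₁′, x₂) − u(x₁″, x₂)| ≤ e^{−σ|x₁|} |x₁′ − x₁″|^α. Let v be a harmonic conjugate of u on S₀ (i.e. v is harmonic in S₀ with ∂_{x₁}v = −∂_{x₂}u and ∂_{x₂}v = ∂_{x₁}u). Then there exist real numbers L₊, L₋ and a constant C such that |v(x₁,x₂) − L₊| ≤ C e^{−σ x₁} for all (x₁,x₂) ∈ S₀ with x₁ > 0, and |v(x₁,x₂) − L₋| ≤ C e^{−σ |x₁|} for all (x₁,x₂) ∈ S₀ with x₁ < 0. -/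
open Complex Set

/-- Second partial derivatives Laplacian for functions on `ℂ ≃ ℝ²`. -/
noncomputable def lap (f : ℂ → ℝ) (z : ℂ) : ℝ :=
  fderiv ℝ (fun w => fderiv ℝ f w 1) z 1 +
    fderiv ℝ (fun w => fderiv ℝ f w Complex.I) z Complex.I

/-- `f` is harmonic on `s`: twice continuously differentiable with vanishing Laplacian. -/
def HarmonicOnSet (f : ℂ → ℝ) (s : Set ℂ) : Prop :=
  ContDiffOn ℝ 2 f s ∧ ∀ z ∈ s, lap f z = 0

/-- The horizontal strip `S₀ = ℝ × (0, π)`. -/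
def S0 : Set ℂ := {z : ℂ | 0 < z.im ∧ z.im < Real.pi}

/-- The closed strip `ℝ × [0, π]`. -/
theorem closure_S0 : closure S0 = {z : ℂ | 0 ≤ z.im ∧ z.im ≤ Real.pi} := by
  have h : S0 = univ ×ℂ Ioo 0 Real.pi := by
    ext z; simp [S0, mem_reProdIm]
  rw [h, closure_reProdIm, closure_univ, closure_Ioo Real.pi_pos.ne]
  ext z; simp [mem_reProdIm]

theorem isOpen_S0 : IsOpen S0 :=
  (isOpen_lt continuous_const continuous_im).inter (isOpen_lt continuous_im continuous_const)

/-- Weak maximum principle for real parts of holomorphic functions on bounded convex open sets. -/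
theorem re_nonpos_of_boundary_nonpos {U : Set ℂ} (hU : IsOpen U) (hconv : Convex ℝ U)
    (hbdd : Bornology.IsBounded U) {h : ℂ → ℝ} {F : ℂ → ℂ} (hcont : ContinuousOn h (closure U))
    (hF : DifferentiableOn ℂ F U) (hre : ∀ z ∈ U, (F z).re = h z)
    (hbd : ∀ z ∈ closure U, z ∉ U → h z ≤ 0) {z : ℂ} (hz : z ∈ U) : h z ≤ 0 := by
  have hcpt : IsCompact (closure U) := hbdd.isCompact_closure
  obtain ⟨c, hc, hmax⟩ := hcpt.exists_isMaxOn ⟨z, subset_closure hz⟩ hcont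
  have hzc : h z ≤ h c := hmax (subset_closure hz)
  refine hzc.trans ?_
  by_cases hcU : c ∈ U
  · have hconst : EqOn h (fun _ => h c) U := by
      have := Complex.norm_eqOn_of_isPreconnected_of_isMaxOn (f := fun w => Complex.exp (F w))
        hconv.isPreconnected hU hF.cexp hcU (by
          intro w hw
          simp only [Function.comp, mem_ofPred_eq, Complex.norm_exp, hre w hw, hre c hcU]
          exact Real.exp_le_exp.2 (hmax (subset_closure hw)))
      intro w hw
      have h2 := this hw
      simpa [Complex.norm_exp, hre w hw, hre c hcU] using h2
    have hconst' : EqOn h (fun _ => h c) (closure U) :=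
      hconst.of_subset_closure hcont continuousOn_const subset_closure subset_rfl
    have : ∃ w ∈ closure U, w ∉ U := by
      by_contra! hcl
      have hclosed : IsClosed U := closure_subset_iff_isClosed.1 hcl
      have huniv : U = univ := IsClopen.eq_univ ⟨hclosed, hU⟩ ⟨z, hz⟩
      exact NormedSpace.unbounded_univ ℝ ℂ (huniv ▸ hbdd)
    obtain ⟨w, hw, hwU⟩ := this
    have h1 := hconst' hw
    have h2 := hbd w hw hwU
    simp only at h1
    linarith
  · exact hbd c hc hcU

/-- A bound on the real part of a holomorphic function controls its derivative at the centre. -/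
theorem norm_deriv_le_of_abs_re_sub_le {f : ℂ → ℂ} {c : ℂ} {r a M : ℝ} {U : Set ℂ} (hr : 0 < r)
    (hM : 0 < M) (hU : Metric.closedBall c r ⊆ U) (hf : DifferentiableOn ℂ f U) (hUo : IsOpen U)
    (hb : ∀ z ∈ Metric.closedBall c r, |(f z).re - a| ≤ M) :
    ‖deriv f c‖ ≤ Real.exp 2 * M / r := by
  have hc : c ∈ Metric.closedBall c r := Metric.mem_closedBall_self hr.le
  have hre : ∀ z, ((f z - a) / (M : ℂ)).re = ((f z).re - a) / M := by
    intro z; rw [Complex.div_ofReal_re]; simp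
  set F : ℂ → ℂ := fun z => Complex.exp ((f z - a) / M)
  have hF : DifferentiableOn ℂ F U := ((hf.sub_const _).div_const _).cexp
  have hcauchy : ‖deriv F c‖ ≤ Real.exp 1 / r := by
    apply Complex.norm_deriv_le_of_forall_mem_sphere_norm_le hr (hF.diffContOnCl_ball hU)
    intro z hz
    rw [Complex.norm_exp, hre]
    apply Real.exp_le_exp.2
    rw [div_le_one hM]
    exact (le_abs_self _).trans (hb z (Metric.sphere_subset_closedBall hz))
  have hd : DifferentiableAt ℂ f c := hf.differentiableAt (hUo.mem_nhds (hU hc))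
  have hder : deriv F c = F c * (deriv f c / M) :=
    ((hd.hasDerivAt.sub_const _).div_const _).cexp.deriv
  have hFc : Real.exp (-1) ≤ ‖F c‖ := by
    rw [Complex.norm_exp, hre]
    apply Real.exp_le_exp.2
    rw [le_div_iff₀ hM]
    linarith [(abs_le.1 (hb c hc)).1]
  rw [hder, norm_mul, norm_div, Complex.norm_real, Real.norm_of_nonneg hM.le] at hcauchy
  have h1 : Real.exp (-1) * (‖deriv f c‖ / M) ≤ Real.exp 1 / r :=
    (mul_le_mul_of_nonneg_right hFc (by positivity)).trans hcauchy
  have h2 : ‖deriv f c‖ / M ≤ Real.exp 1 * (Real.exp 1 / r) := by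
    have := mul_le_mul_of_nonneg_left h1 (Real.exp_pos 1).le
    rwa [← mul_assoc, ← Real.exp_add, add_neg_cancel, Real.exp_zero, one_mul] at this
  rw [div_le_iff₀ hM] at h2
  calc _ ≤ _ := h2
    _ = Real.exp (1 + 1) * M / r := by rw [Real.exp_add]; ring
    _ = _ := by norm_num

/-- The barrier `Re (-i z)^α` on the closed upper half-plane. -/
theorem barrier_lower_bound {α : ℝ} (hα0 : 0 < α) (hα1 : α < 1) {z : ℂ} (hz : 0 ≤ z.im) :
    ‖z‖ ^ α * Real.cos (α * (Real.pi / 2)) ≤ ((-I * z) ^ (α : ℂ)).re := by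
  have harg : |(-I * z).arg| ≤ Real.pi / 2 := by
    rw [Complex.abs_arg_le_pi_div_two_iff]; simpa using hz
  rw [Complex.cpow_ofReal_re, norm_mul, norm_neg, norm_I, one_mul]
  apply mul_le_mul_of_nonneg_left _ (by positivity)
  rw [← Real.cos_abs (arg _ * _), abs_mul, abs_of_pos hα0, mul_comm α]
  apply Real.cos_le_cos_of_nonneg_of_le_pi (by positivity) (by nlinarith [Real.pi_pos])
  exact mul_le_mul_of_nonneg_right harg hα0.le

theorem continuousOn_barrier {α : ℝ} (hα0 : 0 < α) (a : ℂ) :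
    ContinuousOn (fun z : ℂ => (-I * (z - a)) ^ (α : ℂ)) {z | a.im ≤ z.im} := by
  intro z hz
  apply ContinuousAt.continuousWithinAt
  have hlin : ContinuousAt (fun z : ℂ => (-I * (z - a), (α : ℂ))) z := by fun_prop
  by_cases h : z = a
  · subst h
    have := Complex.continuousAt_cpow_zero_of_re_pos (z := (α : ℂ)) (by simpa using hα0)
    exact ContinuousAt.comp' (f := fun w : ℂ => (-I * (w - z), (α : ℂ)))
      (by simpa using this) hlin
  · have hs : -I * (z - a) ∈ slitPlane := by
      rw [Complex.mem_slitPlane_iff]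
      have h1 : a.im ≤ z.im := hz
      have h2 : ¬ (z.re = a.re ∧ z.im = a.im) := fun h' => h (Complex.ext h'.1 h'.2)
      simp only [neg_mul, neg_re, mul_re, I_re, zero_mul, I_im, one_mul, sub_im, zero_sub, neg_neg,
        neg_im, mul_im, sub_re, zero_add, ne_eq, neg_eq_zero]
      by_cases h3 : z.im = a.im
      · right; intro h4; exact h2 ⟨by linarith, h3⟩
      · left; exact sub_pos.2 (lt_of_le_of_ne h1 (Ne.symm h3))
    exact ContinuousAt.comp' (f := fun w : ℂ => (-I * (w - a), (α : ℂ)))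
      (continuousAt_cpow (p := (-I * (z - a), (α : ℂ))) hs) hlin

theorem differentiableOn_barrier (α : ℝ) (a : ℂ) :
    DifferentiableOn ℂ (fun z : ℂ => (-I * (z - a)) ^ (α : ℂ)) {z | a.im < z.im} := by
  intro z hz
  apply DifferentiableAt.differentiableWithinAt
  apply DifferentiableAt.cpow_const (by fun_prop)
  left
  simpa using hz

/-- A holomorphic `f` on the strip whose real part extends to `u`, subject to the exponential
decay and weighted Hölder conditions. -/
structure StripData (σ α : ℝ) (u : ℂ → ℝ) (f : ℂ → ℂ) : Prop where
  cont : ContinuousOn u (closure S0)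
  diff : DifferentiableOn ℂ f S0
  re_eq : ∀ z ∈ S0, (f z).re = u z
  decay : ∀ z ∈ closure S0, |u z| ≤ Real.exp (-σ * |z.re|)
  holder : ∀ x₁ x₂ : ℝ, (x₂ = 0 ∨ x₂ = Real.pi) →
      ∀ x' ∈ Set.Icc (x₁ - 1) (x₁ + 1), ∀ x'' ∈ Set.Icc (x₁ - 1) (x₁ + 1),
        |u ((x' : ℂ) + (x₂ : ℂ) * Complex.I) - u ((x'' : ℂ) + (x₂ : ℂ) * Complex.I)| ≤
          Real.exp (-σ * |x₁|) * |x' - x''| ^ α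

/-- The half-turn of the strip about its centre preserves the hypotheses. -/
theorem StripData.rotate {σ α : ℝ} {u : ℂ → ℝ} {f : ℂ → ℂ} (h : StripData σ α u f) :
    StripData σ α (fun z => u (Real.pi * I - z)) (fun z => f (Real.pi * I - z)) := by
  have hS : MapsTo (fun z : ℂ => Real.pi * I - z) S0 S0 := by
    intro z hz
    simp only [S0, mem_ofPred_eq] at hz
    constructor <;> simp <;> linarith
  have hS' : MapsTo (fun z : ℂ => Real.pi * I - z) (closure S0) (closure S0) :=
    hS.closure (by fun_prop)
  refine ⟨h.cont.comp (by fun_prop) hS', h.diff.comp (by fun_prop) hS,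
    fun z hz => h.re_eq _ (hS hz), fun z hz => ?_, ?_⟩
  · simpa using h.decay _ (hS' hz)
  · intro x₁ x₂ hx₂ x' hx' x'' hx''
    have := h.holder (-x₁) (Real.pi - x₂)
      (by rcases hx₂ with h | h <;> simp [h]) (-x') ⟨by linarith [hx'.2], by linarith [hx'.1]⟩
      (-x'') ⟨by linarith [hx''.2], by linarith [hx''.1]⟩
    rw [abs_neg, show -x' - -x'' = -(x' - x'') by ring, abs_neg] at this
    convert this using 4 <;> push_cast <;> ring

theorem exp_decay_le {σ : ℝ} (hσ0 : 0 < σ) (hσ1 : σ < 1) {x y : ℝ} (h : |x - y| ≤ 1) :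
    Real.exp (-σ * |x|) ≤ Real.exp 1 * Real.exp (-σ * |y|) := by
  rw [← Real.exp_add]
  apply Real.exp_le_exp.2
  have h1 : |y| ≤ |x| + |x - y| := by
    have := abs_sub_abs_le_abs_sub y x
    rw [abs_sub_comm y x] at this
    linarith
  nlinarith [abs_nonneg (x - y)]

theorem StripData.boundary_holder {σ α : ℝ} {u : ℂ → ℝ} {f : ℂ → ℂ} (h : StripData σ α u f)
    (hσ0 : 0 < σ) (hσ1 : σ < 1) (hα0 : 0 < α) (hα1 : α < 1) :
    ∃ K : ℝ, 0 < K ∧ ∀ (x : ℝ) (z : ℂ), 0 < z.im → ‖z - x‖ < 1 →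
      |u z - u x| ≤ K * Real.exp (-σ * |x|) * ‖z - x‖ ^ α := by
  have hcos : 0 < Real.cos (α * (Real.pi / 2)) :=
    Real.cos_pos_of_mem_Ioo ⟨by nlinarith [Real.pi_pos], by nlinarith [Real.pi_pos]⟩
  set k := Real.cos (α * (Real.pi / 2))
  have he : (1 : ℝ) ≤ Real.exp 1 := Real.one_le_exp (by norm_num)
  refine ⟨2 * Real.exp 1 / k, by positivity, fun x z hz hzx => ?_⟩
  set E := Real.exp (-σ * |x|)
  have hE : 0 < E := Real.exp_pos _
  set K := 2 * Real.exp 1 / k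
  have hKk : K * k = 2 * Real.exp 1 := div_mul_cancel₀ _ hcos.ne'
  have hK : 0 < K := by positivity
  set g : ℂ → ℂ := fun z => (-I * (z - x)) ^ (α : ℂ)
  set U : Set ℂ := Metric.ball (x : ℂ) 1 ∩ {w | 0 < w.im}
  have hU : IsOpen U := Metric.isOpen_ball.inter (isOpen_lt continuous_const continuous_im)
  have hconv : Convex ℝ U := (convex_ball _ _).inter (convex_halfSpace_im_gt 0)
  have hbdd : Bornology.IsBounded U := Metric.isBounded_ball.subset inter_subset_left
  have him : ∀ w : ℂ, ‖w - x‖ ≤ 1 → w.im ≤ 1 := fun w hw => by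
    have := (le_abs_self _).trans (Complex.abs_im_le_norm (w - x))
    simp at this; linarith
  have hpi := Real.pi_gt_three
  have hUS : U ⊆ S0 := fun w hw => by
    have h1 : ‖w - x‖ < 1 := by simpa [dist_eq_norm] using hw.1
    have h2 := him w h1.le
    have h3 : 0 < w.im := hw.2
    exact ⟨h3, by linarith⟩
  have hclU : ∀ w ∈ closure U, ‖w - x‖ ≤ 1 ∧ 0 ≤ w.im := fun w hw => by
    constructor
    · have := closure_mono (inter_subset_left) hw
      rw [closure_ball _ one_ne_zero] at this
      simpa [dist_eq_norm] using this
    · have : closure U ⊆ {w : ℂ | 0 ≤ w.im} :=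
        closure_minimal (fun w hw => show 0 ≤ w.im from le_of_lt hw.2) (isClosed_le continuous_const continuous_im)
      exact this hw
  have hxS : (x : ℂ) ∈ closure S0 := by rw [closure_S0]; simp [Real.pi_pos.le]
  have hg0 : ∀ w : ℂ, 0 ≤ w.im → ‖w - x‖ ^ α * k ≤ (g w).re := fun w hw =>
    barrier_lower_bound hα0 hα1 (z := w - x) (by simpa using hw)
  have hgc : ContinuousOn g {w | 0 ≤ w.im} := by
    simpa only [ofReal_im] using continuousOn_barrier hα0 (x : ℂ)
  have hgd : DifferentiableOn ℂ g {w | 0 < w.im} := by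
    simpa only [ofReal_im] using differentiableOn_barrier α (x : ℂ)
  have hbdry : ∀ w ∈ closure U, w ∉ U → |u w - u x| ≤ K * E * (g w).re := by
    intro w hw hwU
    obtain ⟨h1, h2⟩ := hclU w hw
    have hlow : 2 * Real.exp 1 * E * ‖w - x‖ ^ α ≤ K * E * (g w).re := by
      have := mul_le_mul_of_nonneg_left (hg0 w h2) (mul_pos hK hE).le
      rw [← hKk]; linarith
    refine le_trans ?_ hlow
    rcases h2.eq_or_lt with h3 | h3
    · have hwre : w = (w.re : ℂ) := by apply Complex.ext <;> simp [← h3]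
      have habs : ‖w - x‖ = |w.re - x| := by
        rw [hwre, ← ofReal_sub, Complex.norm_real]; simp
      have h5 := abs_le.1 (habs ▸ h1)
      have := h.holder x 0 (Or.inl rfl) w.re ⟨by linarith, by linarith⟩ x ⟨by linarith, by linarith⟩
      simp only [ofReal_zero, zero_mul, add_zero, ← hwre, ← habs] at this
      refine this.trans ?_
      have : 0 ≤ E * ‖w - x‖ ^ α := by positivity
      nlinarith
    · have h4 : ‖w - x‖ = 1 := by
        refine le_antisymm h1 (not_lt.1 fun hlt => hwU ⟨by simpa [dist_eq_norm] using hlt, h3⟩)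
      rw [h4, Real.one_rpow, mul_one]
      have hwS : w ∈ closure S0 := by
        rw [closure_S0]; exact ⟨h2, by linarith [him w h1]⟩
      have e1 := h.decay w hwS
      have e2 := h.decay x hxS
      rw [ofReal_re] at e2
      have e3 := exp_decay_le hσ0 hσ1 (x := w.re) (y := x) (by
        have := Complex.abs_re_le_norm (w - x)
        simp only [sub_re, ofReal_re] at this; linarith)
      have e4 := abs_sub (u w) (u x)
      change |u x| ≤ E at e2
      change _ ≤ Real.exp 1 * E at e3
      nlinarith
  have hside : ∀ s : ℝ, |s| ≤ 1 → s * (u z - u x) - K * E * (g z).re ≤ 0 := by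
    intro s hs
    refine re_nonpos_of_boundary_nonpos hU hconv hbdd
      (h := fun w => s * (u w - u x) - K * E * (g w).re)
      (F := fun w => (s : ℂ) * (f w - (u x : ℂ)) - ((K * E : ℝ) : ℂ) * g w) ?_ ?_ ?_ ?_
      ⟨by simpa [dist_eq_norm] using hzx, hz⟩
    · have c1 := h.cont.mono (closure_mono hUS)
      have c2 := continuous_re.comp_continuousOn (hgc.mono fun w hw => (hclU w hw).2)
      exact (continuousOn_const.mul (c1.sub continuousOn_const)).sub (continuousOn_const.mul c2)
    · have d1 := h.diff.mono hUS
      have d2 := hgd.mono (inter_subset_right : U ⊆ _)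
      exact ((d1.sub_const _).const_mul _).sub (d2.const_mul _)
    · intro w hw
      simp only [sub_re, re_ofReal_mul, ofReal_re, h.re_eq w (hUS hw)]
    · intro w hw hwU
      have h1 := hbdry w hw hwU
      have h2 : s * (u w - u x) ≤ |u w - u x| := by
        refine (le_abs_self _).trans ?_
        rw [abs_mul]
        exact mul_le_of_le_one_left (abs_nonneg _) hs
      linarith
  have hup : (g z).re ≤ ‖z - x‖ ^ α := by
    simp only [g]
    rw [Complex.cpow_ofReal_re, norm_mul, norm_neg, norm_I, one_mul]
    exact mul_le_of_le_one_right (by positivity) (Real.cos_le_one _)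
  have hup' := mul_le_mul_of_nonneg_left hup (mul_pos hK hE).le
  rw [abs_le]
  have := hside 1 (by simp)
  have := hside (-1) (by simp)
  constructor <;> linarith

/-- Gradient bound on the lower half of the strip, integrable up to the boundary. -/
theorem StripData.norm_deriv_le {σ α : ℝ} {u : ℂ → ℝ} {f : ℂ → ℂ} (h : StripData σ α u f)
    (hσ0 : 0 < σ) (hσ1 : σ < 1) (hα0 : 0 < α) (hα1 : α < 1) :
    ∃ C : ℝ, 0 < C ∧ ∀ z : ℂ, 0 < z.im → z.im ≤ Real.pi / 2 →
      ‖deriv f z‖ ≤ C * Real.exp (-σ * |z.re|) * z.im ^ (α - 1) := by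
  obtain ⟨K, hK, hKb⟩ := h.boundary_holder hσ0 hσ1 hα0 hα1
  refine ⟨Real.exp 2 * (4 * K + 8 * Real.exp 1), by positivity, fun z hz hz' => ?_⟩
  have hE : 0 < Real.exp (-σ * |z.re|) := Real.exp_pos _
  set E := Real.exp (-σ * |z.re|)
  have hpi := Real.pi_gt_three
  have hpi4 := Real.pi_le_four
  have him : ∀ r, ∀ w ∈ Metric.closedBall z r, |w.im - z.im| ≤ r ∧ |w.re - z.re| ≤ r := by
    intro r w hw
    rw [Metric.mem_closedBall, dist_eq_norm] at hw
    exact ⟨(Complex.abs_im_le_norm (w - z)).trans hw, (Complex.abs_re_le_norm (w - z)).trans hw⟩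
  rcases le_or_gt z.im (1 / 2) with hy | hy
  · have hsub : Metric.closedBall z (z.im / 2) ⊆ S0 := by
      intro w hw
      have := abs_le.1 (him _ w hw).1
      exact ⟨by linarith, by linarith⟩
    have hyα : 0 < z.im ^ α := Real.rpow_pos_of_pos hz _
    have := norm_deriv_le_of_abs_re_sub_le (a := u z.re) (M := K * E * (2 * z.im ^ α))
      (half_pos hz) (by positivity) hsub h.diff isOpen_S0 (by
        intro w hw
        rw [h.re_eq w (hsub hw)]
        have hdist : ‖w - z.re‖ ≤ 3 / 2 * z.im := by
          have h1 : ‖z - z.re‖ = z.im := by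
            have : z - z.re = z.im * I := by apply Complex.ext <;> simp
            rw [this, norm_mul, norm_I, mul_one, Complex.norm_real, Real.norm_of_nonneg hz.le]
          have h2 := norm_add_le (w - z) (z - z.re)
          rw [sub_add_sub_cancel, h1] at h2
          have h3 := Metric.mem_closedBall.1 hw
          rw [dist_eq_norm] at h3
          linarith
        refine (hKb z.re w (hsub hw).1 (by linarith)).trans ?_
        apply mul_le_mul_of_nonneg_left _ (by positivity)
        calc ‖w - z.re‖ ^ α ≤ (2 * z.im) ^ α :=
              Real.rpow_le_rpow (norm_nonneg _) (by linarith) hα0.le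
          _ = 2 ^ α * z.im ^ α := Real.mul_rpow (by norm_num) hz.le
          _ ≤ 2 * z.im ^ α := by
              apply mul_le_mul_of_nonneg_right _ hyα.le
              exact Real.rpow_le_self_of_one_le (by norm_num) hα1.le)
    refine this.trans ?_
    rw [Real.rpow_sub_one hz.ne']
    have : Real.exp 2 * (K * E * (2 * z.im ^ α)) / (z.im / 2)
        = Real.exp 2 * (4 * K) * E * (z.im ^ α / z.im) := by field_simp; ring
    rw [this]
    gcongr
    linarith [Real.exp_pos 1]
  · have hsub : Metric.closedBall z (1 / 4) ⊆ S0 := by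
      intro w hw
      have := abs_le.1 (him _ w hw).1
      exact ⟨by linarith, by linarith⟩
    have := norm_deriv_le_of_abs_re_sub_le (a := 0) (M := Real.exp 1 * E)
      (r := 1 / 4) (by norm_num) (by positivity) hsub h.diff isOpen_S0 (by
        intro w hw
        rw [h.re_eq w (hsub hw), sub_zero]
        exact (h.decay w (subset_closure (hsub hw))).trans
          (exp_decay_le hσ0 hσ1 ((him _ w hw).2.trans (by norm_num))))
    refine this.trans ?_
    have hlow : 1 / 2 ≤ z.im ^ (α - 1) := by
      calc (1 / 2 : ℝ) = 2 ^ (-1 : ℝ) := by norm_num [Real.rpow_neg_one]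
        _ ≤ 2 ^ (α - 1) := Real.rpow_le_rpow_of_exponent_le (by norm_num) (by linarith)
        _ ≤ z.im ^ (α - 1) :=
            Real.rpow_le_rpow_of_nonpos hz (by linarith) (by linarith)
    calc Real.exp 2 * (Real.exp 1 * E) / (1 / 4)
        = Real.exp 2 * (8 * Real.exp 1) * E * (1 / 2) := by ring
      _ ≤ Real.exp 2 * (4 * K + 8 * Real.exp 1) * E * z.im ^ (α - 1) := by
          gcongr
          linarith

theorem mem_S0_of_le_half {z : ℂ} (h0 : 0 < z.im) (h1 : z.im ≤ Real.pi / 2) : z ∈ S0 :=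
  ⟨h0, by linarith [Real.pi_pos]⟩

/-- In the lower half of the strip, `f` is exponentially close to its value on the midline. -/
theorem StripData.norm_sub_midline_le {σ α : ℝ} {u : ℂ → ℝ} {f : ℂ → ℂ} (h : StripData σ α u f)
    (hσ0 : 0 < σ) (hσ1 : σ < 1) (hα0 : 0 < α) (hα1 : α < 1) :
    ∃ C : ℝ, 0 < C ∧ ∀ z : ℂ, 0 < z.im → z.im ≤ Real.pi / 2 →
      ‖f (z.re + (Real.pi / 2 : ℝ) * I) - f z‖ ≤ C * Real.exp (-σ * |z.re|) := by
  obtain ⟨C, hC, hCb⟩ := h.norm_deriv_le hσ0 hσ1 hα0 hα1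
  refine ⟨C * ((Real.pi / 2) ^ α / α), by have := Real.pi_pos; positivity, fun z hz hz' => ?_⟩
  have hE : 0 < Real.exp (-σ * |z.re|) := Real.exp_pos _
  set E := Real.exp (-σ * |z.re|)
  have hd : ∀ t ∈ Icc z.im (Real.pi / 2),
      HasDerivAt (fun t : ℝ => f (z.re + t * I) - f z) (deriv f (z.re + t * I) * I) t := by
    intro t ht
    have hS : (z.re + t * I : ℂ) ∈ S0 :=
      mem_S0_of_le_half (by simpa using hz.trans_le ht.1) (by simpa using ht.2)
    have h1 := (h.diff.differentiableAt (isOpen_S0.mem_nhds hS)).hasDerivAt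
    have h2 : HasDerivAt (fun t : ℝ => (z.re + t * I : ℂ)) I t := by
      simpa using ((Complex.ofRealCLM.hasDerivAt (x := t)).mul_const I).const_add (z.re : ℂ)
    exact (h1.comp t h2).sub_const _
  have hB : ∀ t ∈ Icc z.im (Real.pi / 2),
      HasDerivAt (fun t : ℝ => C * E * ((t ^ α - z.im ^ α) / α)) (C * E * t ^ (α - 1)) t := by
    intro t ht
    have := (((Real.hasDerivAt_rpow_const (x := t) (p := α)
      (Or.inl (hz.trans_le ht.1).ne')).sub_const (z.im ^ α)).div_const α).const_mul (C * E)
    rwa [mul_div_cancel_left₀ _ hα0.ne'] at this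
  have := image_norm_le_of_norm_deriv_right_le_deriv_boundary'
    (fun t ht => (hd t ht).continuousAt.continuousWithinAt)
    (fun t ht => (hd t (Ico_subset_Icc_self ht)).hasDerivWithinAt)
    (by simp)
    (fun t ht => (hB t ht).continuousAt.continuousWithinAt)
    (fun t ht => (hB t (Ico_subset_Icc_self ht)).hasDerivWithinAt)
    (fun t ht => by
      have := hCb (z.re + t * I) (by simpa using hz.trans_le ht.1) (by simpa using ht.2.le)
      simpa [E] using this)
    (right_mem_Icc.2 hz')
  refine this.trans ?_
  have hzα : 0 ≤ z.im ^ α := by positivity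
  calc C * E * (((Real.pi / 2) ^ α - z.im ^ α) / α)
      ≤ C * E * ((Real.pi / 2) ^ α / α) := by gcongr; linarith
    _ = _ := by ring

/-- Along the midline `f` has a limit at `+∞`, attained at an exponential rate. -/
theorem StripData.exists_midline_limit {σ α : ℝ} {u : ℂ → ℝ} {f : ℂ → ℂ}
    (h : StripData σ α u f) (hσ0 : 0 < σ) (hσ1 : σ < 1) (hα0 : 0 < α) (hα1 : α < 1) :
    ∃ (L : ℂ) (C : ℝ), ∀ t : ℝ, 0 ≤ t →
      ‖f (t + (Real.pi / 2 : ℝ) * I) - L‖ ≤ C * Real.exp (-σ * t) := by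
  obtain ⟨C, hC, hCb⟩ := h.norm_deriv_le hσ0 hσ1 hα0 hα1
  set D := C * (Real.pi / 2) ^ (α - 1)
  have hpi := Real.pi_pos
  have hD : 0 < D := by positivity
  set p : ℝ → ℂ := fun t => f (t + (Real.pi / 2 : ℝ) * I)
  have hd : ∀ t : ℝ, HasDerivAt p (deriv f (t + (Real.pi / 2 : ℝ) * I)) t := by
    intro t
    have hS : (t + (Real.pi / 2 : ℝ) * I : ℂ) ∈ S0 :=
      mem_S0_of_le_half (by simpa using hpi) (by simp)
    have h1 := (h.diff.differentiableAt (isOpen_S0.mem_nhds hS)).hasDerivAt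
    have h2 : HasDerivAt (fun t : ℝ => (t + (Real.pi / 2 : ℝ) * I : ℂ)) 1 t := by
      simpa using (Complex.ofRealCLM.hasDerivAt (x := t)).add_const ((Real.pi / 2 : ℝ) * I : ℂ)
    exact (h1.comp t h2).congr_deriv (mul_one _)
  have hbound : ∀ s t : ℝ, 0 ≤ s → s ≤ t → ‖p t - p s‖ ≤ D / σ * Real.exp (-σ * s) := by
    intro s t hs hst
    have hB : ∀ t : ℝ, HasDerivAt
        (fun t : ℝ => D / σ * (Real.exp (-σ * s) - Real.exp (-σ * t)))
        (D * Real.exp (-σ * t)) t := by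
      intro t
      have := ((((hasDerivAt_id t).const_mul (-σ)).exp).const_sub
        (Real.exp (-σ * s))).const_mul (D / σ)
      refine this.congr_deriv ?_
      simp only [id]
      field_simp
    have := image_norm_le_of_norm_deriv_right_le_deriv_boundary (f := fun t => p t - p s)
      (a := s) (b := t)
      (fun t _ => ((hd t).sub_const (p s)).continuousAt.continuousWithinAt)
      (fun t _ => ((hd t).sub_const (p s)).hasDerivWithinAt)
      (by simp) hB
      (fun t ht => by
        have := hCb (t + (Real.pi / 2 : ℝ) * I) (by simpa using hpi) (by simp)
        have ht0 : 0 ≤ t := hs.trans ht.1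
        simp only [add_re, ofReal_re, mul_re, I_re, mul_zero, ofReal_im, I_im, mul_one, sub_self,
          add_zero, abs_of_nonneg ht0, add_im, mul_im, zero_add] at this
        exact this.trans_eq (by ring))
      (right_mem_Icc.2 hst)
    refine this.trans ?_
    gcongr
    linarith [Real.exp_pos (-σ * t)]
  have hlim : Filter.Tendsto (fun s : ℝ => D / σ * Real.exp (-σ * s)) Filter.atTop (nhds 0) := by
    have h1 : Filter.Tendsto (fun s : ℝ => -σ * s) Filter.atTop Filter.atBot :=
      Filter.tendsto_id.const_mul_atTop_of_neg (neg_neg_of_pos hσ0)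
    simpa using (Real.tendsto_exp_atBot.comp h1).const_mul (D / σ)
  have hcauchy : CauchySeq p := by
    rw [Metric.cauchySeq_iff']
    intro ε hε
    obtain ⟨N, hN, hN0⟩ := ((hlim.eventually_lt_const hε).and (Filter.eventually_ge_atTop 0)).exists
    exact ⟨N, fun n hn => by
      rw [dist_eq_norm]; exact (hbound N n hN0 hn).trans_lt hN⟩
  obtain ⟨L, hL⟩ := cauchySeq_tendsto_of_complete hcauchy
  refine ⟨L, D / σ, fun t ht => ?_⟩
  rw [norm_sub_rev]
  refine le_of_tendsto ((hL.sub_const (p t)).norm) ?_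
  filter_upwards [Filter.eventually_ge_atTop t] with s hs
  exact hbound t s ht hs

/-- `f` converges at `+∞` at an exponential rate, uniformly on the right half of the strip. -/
theorem StripData.exists_limit {σ α : ℝ} {u : ℂ → ℝ} {f : ℂ → ℂ}
    (h : StripData σ α u f) (hσ0 : 0 < σ) (hσ1 : σ < 1) (hα0 : 0 < α) (hα1 : α < 1) :
    ∃ (L : ℂ) (C : ℝ), ∀ z ∈ S0, 0 < z.re → ‖f z - L‖ ≤ C * Real.exp (-σ * z.re) := by
  obtain ⟨L, C₀, hL⟩ := h.exists_midline_limit hσ0 hσ1 hα0 hα1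
  obtain ⟨C₁, hC₁, h₁⟩ := h.norm_sub_midline_le hσ0 hσ1 hα0 hα1
  obtain ⟨C₂, hC₂, h₂⟩ := h.rotate.norm_sub_midline_le hσ0 hσ1 hα0 hα1
  refine ⟨L, C₀ + C₁ + C₂, fun z hz hre => ?_⟩
  set m : ℂ := z.re + (Real.pi / 2 : ℝ) * I
  have hE := Real.exp_pos (-σ * z.re)
  have key : ‖f m - f z‖ ≤ (C₁ + C₂) * Real.exp (-σ * z.re) := by
    rcases le_total z.im (Real.pi / 2) with hy | hy
    · have := h₁ z hz.1 hy
      rw [abs_of_pos hre] at this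
      nlinarith
    · have := h₂ (Real.pi * I - z) (by simpa using hz.2)
        (by simp only [sub_im, mul_im, ofReal_re, I_im, mul_one, ofReal_im, I_re, mul_zero,
              add_zero]; linarith)
      have hm : (Real.pi * I - (((Real.pi * I - z).re : ℝ) + (Real.pi / 2 : ℝ) * I) : ℂ) = m := by
        apply Complex.ext <;> simp [m]
        ring
      rw [hm, sub_sub_cancel] at this
      simp only [sub_re, mul_re, ofReal_re, I_re, mul_zero, ofReal_im, I_im, mul_one, sub_self,
        zero_sub, abs_neg, abs_of_pos hre] at this
      nlinarith
  have := hL z.re hre.le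
  calc ‖f z - L‖ = ‖(f m - L) - (f m - f z)‖ := by congr 1; ring
    _ ≤ ‖f m - L‖ + ‖f m - f z‖ := norm_sub_le _ _
    _ ≤ _ := by linarith

/-- The Cauchy–Riemann equations make `u + i v` holomorphic. -/
theorem differentiableOn_add_mul_I {u v : ℂ → ℝ} {s : Set ℂ} (hs : IsOpen s)
    (hu : DifferentiableOn ℝ u s) (hv : DifferentiableOn ℝ v s)
    (hcr : ∀ z ∈ s, fderiv ℝ v z 1 = -(fderiv ℝ u z I) ∧ fderiv ℝ v z I = fderiv ℝ u z 1) :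
    DifferentiableOn ℂ (fun z => (u z : ℂ) + v z * I) s := by
  intro z hz
  apply DifferentiableAt.differentiableWithinAt
  have hu' := (hu.differentiableAt (hs.mem_nhds hz)).hasFDerivAt
  have hv' := (hv.differentiableAt (hs.mem_nhds hz)).hasFDerivAt
  have hd : HasFDerivAt (fun z => (u z : ℂ) + v z * I) _ z :=
    (Complex.ofRealCLM.hasFDerivAt.comp z hu').add
      ((Complex.ofRealCLM.hasFDerivAt.comp z hv').mul_const I)
  rw [differentiableAt_complex_iff_differentiableAt_real]
  refine ⟨hd.differentiableAt, ?_⟩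
  rw [hd.fderiv]
  obtain ⟨h1, h2⟩ := hcr z hz
  apply Complex.ext <;> simp [h1, h2]

/-- under the hypotheses of Statement 11, a harmonic conjugate `v` of `u`
(`∂₁v = −∂₂u`, `∂₂v = ∂₁u`) has limits `L₊`, `L₋` at `x₁ → ±∞` with exponential rate:
`|v − L₊| ≤ C e^{−σ x₁}` for `x₁ > 0` and `|v − L₋| ≤ C e^{−σ|x₁|}` for `x₁ < 0`. -/
theorem statement12 (σ α : ℝ) (hσ0 : 0 < σ) (hσ1 : σ < 1) (hα0 : 0 < α) (hα1 : α < 1)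
    (u : ℂ → ℝ)
    (hc : ContinuousOn u (closure S0))
    (hh : HarmonicOnSet u S0)
    (hb : ∀ z ∈ closure S0, |u z| ≤ Real.exp (-σ * |z.re|))
    (hhold : ∀ x₁ x₂ : ℝ, (x₂ = 0 ∨ x₂ = Real.pi) →
      ∀ x' ∈ Set.Icc (x₁ - 1) (x₁ + 1), ∀ x'' ∈ Set.Icc (x₁ - 1) (x₁ + 1),
        |u ((x' : ℂ) + (x₂ : ℂ) * Complex.I) - u ((x'' : ℂ) + (x₂ : ℂ) * Complex.I)| ≤
          Real.exp (-σ * |x₁|) * |x' - x''| ^ α)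
    (v : ℂ → ℝ)
    (hvh : HarmonicOnSet v S0)
    (hcr : ∀ z ∈ S0, fderiv ℝ v z 1 = -(fderiv ℝ u z Complex.I) ∧
      fderiv ℝ v z Complex.I = fderiv ℝ u z 1) :
    ∃ Lp Lm C : ℝ,
      (∀ z ∈ S0, 0 < z.re → |v z - Lp| ≤ C * Real.exp (-σ * z.re)) ∧
      (∀ z ∈ S0, z.re < 0 → |v z - Lm| ≤ C * Real.exp (-σ * |z.re|)) := by
  have hf : DifferentiableOn ℂ (fun z => (u z : ℂ) + v z * I) S0 :=
    differentiableOn_add_mul_I isOpen_S0 (hh.1.differentiableOn (by norm_num))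
      (hvh.1.differentiableOn (by norm_num)) hcr
  have h : StripData σ α u (fun z => (u z : ℂ) + v z * I) :=
    ⟨hc, hf, fun z _ => by simp, hb, hhold⟩
  obtain ⟨Lp, C₁, h₁⟩ := h.exists_limit hσ0 hσ1 hα0 hα1
  obtain ⟨Lm, C₂, h₂⟩ := h.rotate.exists_limit hσ0 hσ1 hα0 hα1
  refine ⟨Lp.im, Lm.im, max C₁ C₂, fun z hz hre => ?_, fun z hz hre => ?_⟩
  · have e1 := (Complex.abs_im_le_norm _).trans (h₁ z hz hre)
    simp only [sub_im, add_im, ofReal_im, mul_im, ofReal_re, I_im, mul_one, I_re, mul_zero,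
      add_zero, zero_add] at e1
    exact e1.trans (mul_le_mul_of_nonneg_right (le_max_left _ _) (Real.exp_pos _).le)
  · have e1 := (Complex.abs_im_le_norm _).trans (h₂ (Real.pi * I - z)
      ⟨by simpa using hz.2, by simpa using hz.1⟩ (by simpa using hre))
    rw [sub_sub_cancel] at e1
    simp only [sub_im, add_im, ofReal_im, mul_im, ofReal_re, I_im, mul_one, I_re, mul_zero,
      add_zero, zero_add, sub_re, mul_re, sub_self, zero_sub] at e1
    rw [abs_of_neg hre]
    exact e1.trans (mul_le_mul_of_nonneg_right (le_max_right _ _) (Real.exp_pos _).le)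
end
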